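/- (Main Lemma (v)) Let e=(u,v) be a non-leaf-edge of depth d−1 in a rooted tree instance, assume all edges of depth at least d satisfy conditions (a) and (b), let ⟨ã,b̃⟩ = Ψ(e1)⊗Ψ(e2) for the two child-edges e1, e2 of e, and assume c(e) < ã and that e1 is dominating with dominating path P_{v,t*} to the terminal t* ∈ T_{e1} guaranteed by condition (b). Then I(e) admits a blocking flow f with f(e) = c(e); namely, choosing a blocking flow f1 of I(e1) with f1(e1) = a(e1) and a blocking flow f2 of I(e2) with f2(e2) = b(e2), the function f that equals f1 decreased by δ_e = ã − c(e) on each edge of P_{v,t*} on G_{e1}, equals f2 on G_{e2}, and has f(e) = c(e), is a blocking flow of I(e). -/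

import Mathlib

open Classical

/-- `⟨a,b⟩`: the set `{a, a+2, …, b}` of consecutive odd or even integers. -/
def Iv (a b : ℕ) : Set ℕ := {x | a ≤ x ∧ x ≤ b ∧ x % 2 = a % 2}

/-- `A ⊗ B = {a + b − 2i : a ∈ A, b ∈ B, 0 ≤ i ≤ min(a,b)}`. -/
def otimes (A B : Set ℕ) : Set ℕ :=
  {x | ∃ a ∈ A, ∃ b ∈ B, ∃ i, i ≤ min a b ∧ x = a + b - 2 * i}

/-- A tree instance `(G,T,c)` rooted at a terminal `r`: a tree on vertex set `V`,
encoded by the parent function `par` (with `par root = root`) together with a depth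
function certifying acyclicity.  Each non-root vertex `v` is identified with the edge
`(par v, v)`; `c v` is the (positive integer) capacity of that edge.  The terminals are
the leaves; the root has exactly one child and every internal vertex has exactly
two children (total degree 3). -/
structure RTI (V : Type*) where
  root : V
  par : V → V
  dep : V → ℕ
  c : V → ℕ
  par_root : par root = root
  dep_root : dep root = 0
  dep_par : ∀ v, v ≠ root → dep v = dep (par v) + 1
  cap_pos : ∀ v, v ≠ root → 1 ≤ c v
  root_degree : {w : V | par w = root ∧ w ≠ root}.ncard = 1
  internal_degree : ∀ v, v ≠ root → {w : V | par w = v ∧ w ≠ root}.Nonempty →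
    {w : V | par w = v ∧ w ≠ root}.ncard = 2

namespace RTI

variable {V : Type*} (R : RTI V)

/-- `R.below u v`: `v` lies in the subtree rooted at `u` (i.e. `u` is an ancestor of
`v`, allowing `u = v`). -/
def below (u v : V) : Prop :=
  Relation.ReflTransGen (fun a b => R.par b = a ∧ b ≠ R.root) u v

/-- `v` is a leaf of the tree other than the root. -/
def leaf (v : V) : Prop := v ≠ R.root ∧ ∀ w, w ≠ R.root → R.par w ≠ v

/-- The children of `v` (as lower endpoints of child-edges). -/
def children (v : V) : Set V := {w | R.par w = v ∧ w ≠ R.root}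

/-- For an edge `e = (par v, v)`, the vertex set `V_e` of the instance `I(e)`. -/
def Ve (v : V) : Set V := insert (R.par v) {w | R.below v w}

/-- `T_e`: the terminals of `I(e)` other than `u = par v`. -/
def Te (v : V) : Set V := {w | R.below v w ∧ R.leaf w}

/-- The full terminal set `T_e ∪ {u}` of the instance `I(e)`. -/
def S (v : V) : Set V := insert (R.par v) (R.Te v)

/-- The edge `(par x, x)` lies on the tree path between `t` and `t'`
(exactly one of `t, t'` is in the subtree below `x`). -/
def onPath (x t t' : V) : Prop :=
  (R.below x t ∧ ¬ R.below x t') ∨ (¬ R.below x t ∧ R.below x t')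

/-- The vertex `x` lies on the tree path between `t` and `t'`. -/
def onPathV (x t t' : V) : Prop :=
  (R.below x t ∨ R.below x t') ∧ ∀ z, R.below z t → R.below z t' → R.below z x

/-- Unordered pairs of distinct terminals of the instance `I(e)` for `e = (par v, v)`. -/
def PathPairs (v : V) : Set (Sym2 V) :=
  {p | ∃ t t', t ∈ R.S v ∧ t' ∈ R.S v ∧ t ≠ t' ∧ p = s(t, t')}

/-- `g` is a decomposition of `f` in the instance `I(e)`, `e = (par v, v)`:
`g` is supported on pairs of distinct terminals and, on every edge of `I(e)`,
`f` is the sum of `g` over the (unique) terminal-pair paths through that edge. -/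
def IsDecomp (v : V) (f : V → ℕ) (g : Sym2 V → ℕ) : Prop :=
  (∀ p, g p ≠ 0 → p ∈ R.PathPairs v) ∧
  ∀ w, R.below v w →
    f w = ∑ᶠ p ∈ {p : Sym2 V | ∃ t t', p = s(t, t') ∧ R.onPath w t t'}, g p

/-- `f` is an (integral) flow in the instance `I(e)`, `e = (par v, v)`. -/
def IsFlow (v : V) (f : V → ℕ) : Prop := ∃ g, R.IsDecomp v f g

/-- `f` is feasible in `I(e)`. -/
def Feasible (v : V) (f : V → ℕ) : Prop := ∀ w, R.below v w → f w ≤ R.c w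

/-- `V_f(s)`: the set of vertices `w` of `I(e)` reachable from `s` by travelling
upward along edges with `c − f ≥ 1` to a common ancestor and then downward along
edges with `c − f ≥ 2`. -/
def Vf (v : V) (f : V → ℕ) (s : V) : Set V :=
  {w | w ∈ R.Ve v ∧ ∃ z ∈ R.Ve v, R.below z s ∧ R.below z w ∧
    (∀ x, R.below z x → R.below x s → x ≠ z → f x + 1 ≤ R.c x) ∧
    (∀ x, R.below z x → R.below x w → x ≠ z → f x + 2 ≤ R.c x)}

/-- `W` induces a connected subgraph of the tree (it is closed under tree paths). -/
def ConnSet (W : Set V) : Prop :=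
  ∀ w₁ ∈ W, ∀ w₂ ∈ W, ∀ x, R.onPathV x w₁ w₂ → x ∈ W

/-- `E(X)` inside the instance `I(e)`, `e = (par v, v)`: the edges `(par x, x)` of
`I(e)` with exactly one endpoint in `X`. -/
def cutE (v : V) (X : Set V) : Set V :=
  {x | R.below v x ∧ ¬ (x ∈ X ↔ R.par x ∈ X)}

/-- `h(X) = Σ_{e' ∈ E(X)} h(e')` inside the instance `I(e)`, `e = (par v, v)`. -/
noncomputable def hval (v : V) (X : Set V) (h : V → ℕ) : ℕ := ∑ᶠ x ∈ R.cutE v X, h x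

/-- `W` is a connected component of the subgraph of `I(e)` induced by `A`. -/
def IsComp (v : V) (A W : Set V) : Prop :=
  W.Nonempty ∧ W ⊆ A ∧ R.ConnSet W ∧
  (∀ x, R.below v x → x ∈ W → R.par x ∈ A → R.par x ∈ W) ∧
  (∀ x, R.below v x → R.par x ∈ W → x ∈ A → x ∈ W)

/-- `odd(X)` (relative to the union `U` of the removed terminal sets): the components
`W` of `G_e − U` with `c(W)` odd whose parent-edge is a child-edge of `X`. -/
def oddOf (v : V) (U X : Set V) : Set (Set V) :=
  {W | R.IsComp v (R.Ve v \ U) W ∧ Odd (R.hval v W R.c) ∧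
    ∃ y ∈ W, R.par y ∉ W ∧ R.par y ∈ X}

/-- The union of the sets `V_f(t)`, `t ∈ T_e`. -/
def UT (v : V) (f : V → ℕ) : Set V := ⋃ t ∈ R.Te v, R.Vf v f t

/-- The union of the sets `V_f(t)`, `t ∈ T_e ∪ {u}`. -/
def USall (v : V) (f : V → ℕ) : Set V := ⋃ t ∈ R.S v, R.Vf v f t

/-- `f` is a blocking flow in `I(e)`, `e = (par v, v)`: a feasible flow such that
`{V_f(t) : t ∈ T_e}` is a cut-system of `T_e` (pairwise disjoint `t`-sets avoiding the
terminal `u = par v`) each member of which is blocked by `f`, i.e.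
`f(e_t) = f(V_f(t)) = c(V_f(t)) − |odd(V_f(t))|`. -/
def IsBlocking (v : V) (f : V → ℕ) : Prop :=
  R.IsFlow v f ∧ R.Feasible v f ∧
  (∀ t ∈ R.Te v, R.par v ∉ R.Vf v f t) ∧
  (∀ t ∈ R.Te v, ∀ t' ∈ R.Te v, t ≠ t' → R.Vf v f t ∩ R.Vf v f t' = ∅) ∧
  (∀ t ∈ R.Te v, f t = R.hval v (R.Vf v f t) f ∧
    R.hval v (R.Vf v f t) f + (R.oddOf v (R.UT v f) (R.Vf v f t)).ncard
      = R.hval v (R.Vf v f t) R.c)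

/-- `Ψ(e)`: the set of values `f(e)` of blocking flows `f` of `I(e)`, `e = (par v, v)`. -/
def Psi (v : V) : Set ℕ := {x | ∃ f, R.IsBlocking v f ∧ f v = x}

/-- `a(e)`: the least element of `Ψ(e)`. -/
noncomputable def aE (v : V) : ℕ := sInf (R.Psi v)

/-- `b(e)`: the greatest element of `Ψ(e)`. -/
noncomputable def bE (v : V) : ℕ := sSup (R.Psi v)

/-- The edge `(par x, x)` is dominating: `b(e') + 2 ≤ a(e)` for its sibling edge `e'`. -/
def Dominating (x : V) : Prop :=
  x ≠ R.root ∧ ∃ y, y ≠ R.root ∧ y ≠ x ∧ R.par y = R.par x ∧ R.bE y + 2 ≤ R.aE x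

/-- The path from `v` down to `t` consists of dominating edges. -/
def DomPath (v t : V) : Prop :=
  R.below v t ∧ ∀ x, R.below v x → R.below x t → x ≠ v → R.Dominating x

/-- Condition (a) for the edge `e = (par v, v)`. -/
def CondA (v : V) : Prop :=
  (∃ a b, R.Psi v = Iv a b) ∧
  (R.leaf v → R.Psi v = {R.c v}) ∧
  (∀ w₁ w₂, w₁ ≠ w₂ → R.children v = {w₁, w₂} →
    R.Psi v = (otimes (R.Psi w₁) (R.Psi w₂) ∩ Set.Iic (R.c v)) ∪ {R.c v})

/-- Condition (b) for the edge `e = (u,v)`: if `e` has a dominating child-edge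
`e' = (v,w)`, then there is a terminal `t ∈ T_{e'}` with `g(u,t) ≥ a(e)` for every
decomposition `g` of every blocking flow of `I(e)`, and `P_{v,t}` a dominating path. -/
def CondB (v : V) : Prop :=
  ∀ w ∈ R.children v, R.Dominating w →
    ∃ t ∈ R.Te w, R.DomPath v t ∧
      ∀ f g, R.IsBlocking v f → R.IsDecomp v f g → R.aE v ≤ g s(R.par v, t)

/-- `γ(𝒳)` for the cut-system `𝒳 = {V_f(t) : t ∈ T_e ∪ {u}}`. -/
noncomputable def gammaX (v : V) (f : V → ℕ) : ℕ :=
  ∑ᶠ t ∈ R.S v, R.hval v (R.Vf v f t) R.c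

/-- `κ(𝒳)` for the cut-system `𝒳 = {V_f(t) : t ∈ T_e ∪ {u}}`: the number of
components of `G_e − ∪𝒳` of odd capacity. -/
noncomputable def kappaX (v : V) (f : V → ℕ) : ℕ :=
  {W : Set V | R.IsComp v (R.Ve v \ R.USall v f) W ∧ Odd (R.hval v W R.c)}.ncard

end RTI

namespace RTI

section Order

variable {V : Type*} {R : RTI V}

lemma below_refl (u : V) : R.below u u := Relation.ReflTransGen.refl

lemma below.trans {u v w : V} (h : R.below u v) (h' : R.below v w) : R.below u w :=
  Relation.ReflTransGen.trans h h'

lemma par_below {x : V} (hx : x ≠ R.root) : R.below (R.par x) x :=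
  Relation.ReflTransGen.single ⟨rfl, hx⟩

lemma below.dep_le {u v : V} (h : R.below u v) : R.dep u ≤ R.dep v := by
  induction h with
  | refl => exact le_rfl
  | tail _ hbc ih => rw [R.dep_par _ hbc.2, hbc.1]; omega

lemma below.eq_or_par {u x : V} (h : R.below u x) :
    u = x ∨ (x ≠ R.root ∧ R.below u (R.par x)) := by
  rcases Relation.ReflTransGen.cases_tail h with h | ⟨c, hc, h1, h2⟩
  · exact Or.inl h.symm
  · exact Or.inr ⟨h2, h1 ▸ hc⟩

lemma below.par_of_ne {u x : V} (h : R.below u x) (hne : u ≠ x) : R.below u (R.par x) :=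
  (h.eq_or_par.resolve_left hne).2

lemma below.eq_or_child {u x : V} (h : R.below u x) :
    u = x ∨ ∃ c ∈ R.children u, R.below c x := by
  rcases Relation.ReflTransGen.cases_head h with h | ⟨c, hc, h1⟩
  · exact Or.inl h
  · exact Or.inr ⟨c, hc, h1⟩

lemma below.dep_lt {u x : V} (h : R.below u x) (hne : u ≠ x) : R.dep u < R.dep x := by
  rcases h.eq_or_par with h | ⟨h1, h2⟩
  · exact absurd h hne
  · have := h2.dep_le
    rw [R.dep_par x h1]; omega

lemma below.antisymm {u x : V} (h : R.below u x) (h' : R.below x u) : u = x := by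
  by_contra hne
  have := h.dep_lt hne
  have := h'.dep_le
  omega

lemma below.total {a b x : V} (ha : R.below a x) (hb : R.below b x) :
    R.below a b ∨ R.below b a := by
  induction ha with
  | refl => exact Or.inr hb
  | tail hac hcd ih =>
    rcases hb.eq_or_par with h | ⟨_, h⟩
    · subst h
      exact Or.inl (hac.trans (Relation.ReflTransGen.single hcd))
    · rw [hcd.1] at h
      exact ih h

lemma below.ne_root {v x : V} (h : R.below v x) (hv : v ≠ R.root) : x ≠ R.root := by
  rcases h.eq_or_par with h | ⟨h, _⟩
  · exact h ▸ hv
  · exact h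

lemma not_below_par {x : V} (hx : x ≠ R.root) : ¬ R.below x (R.par x) := by
  intro h
  have := h.dep_le
  rw [R.dep_par x hx] at this
  omega

lemma par_ne {x : V} (hx : x ≠ R.root) : R.par x ≠ x := by
  intro h
  exact not_below_par hx (h.symm ▸ below_refl x)

lemma below_of_par_below {u z x : V} (h : R.below u x)
    (h' : R.below (R.par z) u) (hne : u ≠ R.par z) (hzx : R.below z x) : R.below z u := by
  rcases h.total hzx with h1 | h1
  · rcases h1.eq_or_par with h2 | ⟨_, h2⟩
    · exact h2 ▸ below_refl _
    · exact absurd (h2.antisymm h') hne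
  · exact h1

lemma leaf.eq_of_below {t x : V} (ht : R.leaf t) (h : R.below t x) : x = t := by
  rcases h.eq_or_child with h | ⟨c, hc, _⟩
  · exact h.symm
  · exact absurd hc.1 (ht.2 c hc.2)

lemma leaf_or_children [Finite V] {x : V} (hx : x ≠ R.root) :
    R.leaf x ∨ ∃ y z, y ≠ z ∧ R.children x = {y, z} := by
  by_cases h : {w : V | R.par w = x ∧ w ≠ R.root}.Nonempty
  · right
    obtain ⟨y, z, h1, h2⟩ := Set.ncard_eq_two.1 (R.internal_degree x hx h)
    exact ⟨y, z, h1, h2⟩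
  · left
    refine ⟨hx, fun w hw hwx => h ⟨w, hwx, hw⟩⟩

/-- `R.Fork x y z`: the vertex `x` is internal, with child-edges `y` and `z`. -/
structure Fork (R : RTI V) (x y z : V) : Prop where
  ne : y ≠ z
  children_eq : R.children x = {y, z}

namespace Fork

variable {x y z : V}

lemma symm (h : R.Fork x y z) : R.Fork x z y :=
  ⟨h.ne.symm, by rw [h.children_eq, Set.pair_comm]⟩

lemma mem_left (h : R.Fork x y z) : y ∈ R.children x := by rw [h.children_eq]; simp

lemma par_left (h : R.Fork x y z) : R.par y = x := h.mem_left.1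

lemma left_ne_root (h : R.Fork x y z) : y ≠ R.root := h.mem_left.2

lemma par_right (h : R.Fork x y z) : R.par z = x := h.symm.par_left

lemma right_ne_root (h : R.Fork x y z) : z ≠ R.root := h.symm.left_ne_root

lemma below_left (h : R.Fork x y z) : R.below x y := h.par_left ▸ par_below h.left_ne_root

lemma below_right (h : R.Fork x y z) : R.below x z := h.symm.below_left

lemma not_left_below (h : R.Fork x y z) : ¬ R.below y x :=
  fun h' => not_below_par h.left_ne_root (h.par_left.symm ▸ h')

lemma not_right_below (h : R.Fork x y z) : ¬ R.below z x := h.symm.not_left_below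

lemma not_both (h : R.Fork x y z) {w : V} (hy : R.below y w) (hz : R.below z w) : False := by
  have key : ∀ {a b : V}, R.Fork x a b → R.below a b → False := by
    intro a b hab hb
    have := hb.par_of_ne hab.ne
    rw [hab.par_right] at this
    exact hab.not_left_below this
  rcases hy.total hz with h1 | h1
  · exact key h h1
  · exact key h.symm h1

lemma cases (h : R.Fork x y z) {w : V} (hw : R.below x w) :
    w = x ∨ R.below y w ∨ R.below z w := by
  rcases hw.eq_or_child with h1 | ⟨c, hc, h1⟩
  · exact Or.inl h1.symm
  · rw [h.children_eq] at hc
    rcases hc with rfl | hc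
    · exact Or.inr (Or.inl h1)
    · rw [Set.mem_singleton_iff] at hc
      subst hc
      exact Or.inr (Or.inr h1)

lemma not_leaf (h : R.Fork x y z) : ¬ R.leaf x :=
  fun hl => hl.2 y h.left_ne_root h.par_left

end Fork

lemma exists_fork_of_below_ne [Finite V] {x w : V} (hx : x ≠ R.root) (h : R.below x w)
    (hne : x ≠ w) : ∃ y z, R.Fork x y z ∧ R.below y w := by
  rcases leaf_or_children hx with hl | ⟨y, z, h1, h2⟩
  · exact absurd (hl.eq_of_below h).symm hne
  · have hF : R.Fork x y z := ⟨h1, h2⟩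
    rcases hF.cases h with h3 | h3 | h3
    · exact absurd h3.symm hne
    · exact ⟨y, z, hF, h3⟩
    · exact ⟨z, y, hF.symm, h3⟩

/-- Two tree paths descending from `z` separate at an internal vertex. -/
lemma exists_fork_of_not_below [Finite V] {z s t : V} (hz : z ≠ R.root) (hs : R.below z s)
    (ht : R.below z t) (hst : ¬ R.below s t) (hts : ¬ R.below t s) :
    ∃ k y y', R.below z k ∧ R.Fork k y y' ∧ R.below y s ∧ R.below y' t := by
  induction hs using Relation.ReflTransGen.head_induction_on with
  | refl => exact absurd ht hst
  | head hac hcb ih =>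
    rename_i a c
    have hac' : R.below a c := Relation.ReflTransGen.single hac
    have hcs : R.below c s := hcb
    by_cases hct : R.below c t
    · obtain ⟨k, y, y', h1, h2⟩ := ih hac.2 hct
      exact ⟨k, y, y', hac'.trans h1, h2⟩
    · have hat : a ≠ t := fun h => hts (h ▸ hac'.trans hcs)
      obtain ⟨y', y, hF, hy'⟩ := exists_fork_of_below_ne hz ht hat
      have hc : c ∈ R.children a := hac
      rw [hF.children_eq] at hc
      rcases hc with rfl | hc
      · exact absurd hy' hct
      · rw [Set.mem_singleton_iff] at hc
        subst hc
        exact ⟨a, c, y', below_refl a, hF.symm, hcb, hy'⟩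

end Order

section Reach

variable {V : Type*} {R : RTI V} {f f' : V → ℕ} {s t w y z q v : V}

/-- The edges on the way from `s` up to its ancestor `z` have residual capacity at least one. -/
def Up (R : RTI V) (f : V → ℕ) (s z : V) : Prop :=
  R.below z s ∧ ∀ x, R.below z x → R.below x s → x ≠ z → f x + 1 ≤ R.c x

/-- The edges on the way from `z` down to its descendant `w` have residual capacity
at least two. -/
def Down (R : RTI V) (f : V → ℕ) (z w : V) : Prop :=
  R.below z w ∧ ∀ x, R.below z x → R.below x w → x ≠ z → f x + 2 ≤ R.c x

lemma mem_Vf : w ∈ R.Vf v f s ↔ w ∈ R.Ve v ∧ ∃ z ∈ R.Ve v, R.Up f s z ∧ R.Down f z w := by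
  unfold Vf Up Down
  simp only [Set.mem_ofPred_eq]
  constructor
  · rintro ⟨h, z, h1, h2, h3, h4, h5⟩
    exact ⟨h, z, h1, ⟨h2, h4⟩, h3, h5⟩
  · rintro ⟨h, z, h1, ⟨h2, h4⟩, h3, h5⟩
    exact ⟨h, z, h1, h2, h3, h4, h5⟩

lemma Up.refl (s : V) : R.Up f s s :=
  ⟨below_refl s, fun _ h1 h2 h3 => absurd (h2.antisymm h1) h3⟩

lemma Down.refl (s : V) : R.Down f s s :=
  ⟨below_refl s, fun _ h1 h2 h3 => absurd (h2.antisymm h1) h3⟩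

lemma Up.congr (h : R.Up f s z)
    (hff : ∀ x, R.below z x → R.below x s → x ≠ z → f' x ≤ f x) : R.Up f' s z :=
  ⟨h.1, fun x h1 h2 h3 => by have := h.2 x h1 h2 h3; have := hff x h1 h2 h3; omega⟩

lemma Down.congr (h : R.Down f z w)
    (hff : ∀ x, R.below z x → R.below x w → x ≠ z → f' x ≤ f x) : R.Down f' z w :=
  ⟨h.1, fun x h1 h2 h3 => by have := h.2 x h1 h2 h3; have := hff x h1 h2 h3; omega⟩

lemma Up.mono_top (h : R.Up f s z) (hy : R.below z y) (hys : R.below y s) : R.Up f s y :=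
  ⟨hys, fun x h1 h2 h3 => h.2 x (hy.trans h1) h2
    fun hx => h3 (by subst hx; exact hy.antisymm h1)⟩

lemma Up.extend (h : R.Up f s z) (hq : q ≠ R.root) (hqz : R.below q z)
    (hres : ∀ x, R.below q x → R.below x z → f x + 1 ≤ R.c x) : R.Up f s (R.par q) := by
  refine ⟨((par_below hq).trans hqz).trans h.1, fun x h1 h2 h3 => ?_⟩
  have hqx : R.below q x := below_of_par_below h2 h1 h3 (hqz.trans h.1)
  by_cases hxz : R.below x z
  · exact hres x hqx hxz
  · exact h.2 x ((h2.total h.1).resolve_left hxz) h2 fun hx => hxz (hx ▸ below_refl _)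

lemma Up.step (h : R.Up f s z) (hz : z ≠ R.root) (hres : f z + 1 ≤ R.c z) :
    R.Up f s (R.par z) :=
  h.extend hz (below_refl z) fun x h1 h2 => by rw [h2.antisymm h1]; exact hres

lemma Down.mono_top (h : R.Down f z w) (hy : R.below z y) (hyw : R.below y w) :
    R.Down f y w :=
  ⟨hyw, fun x h1 h2 h3 => h.2 x (hy.trans h1) h2
    fun hx => h3 (by subst hx; exact hy.antisymm h1)⟩

lemma Down.mono_bot (h : R.Down f z w) (hy : R.below z y) (hyw : R.below y w) :
    R.Down f z y :=
  ⟨hy, fun x h1 h2 h3 => h.2 x h1 (h2.trans hyw) h3⟩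

lemma Down.trans (h : R.Down f z y) (h' : R.Down f y w) : R.Down f z w := by
  refine ⟨h.1.trans h'.1, fun x h1 h2 h3 => ?_⟩
  by_cases hxy : R.below x y
  · exact h.2 x h1 hxy h3
  · exact h'.2 x ((h2.total h'.1).resolve_left hxy) h2 fun hx => hxy (hx ▸ below_refl _)

lemma Down.single (hy : y ≠ R.root) (hres : f y + 2 ≤ R.c y) : R.Down f (R.par y) y :=
  ⟨par_below hy, fun x h1 h2 h3 => by
    rw [h2.antisymm (below_of_par_below h2 h1 h3 (below_refl y))]; exact hres⟩

lemma self_mem_Vf (ht : R.below v t) : t ∈ R.Vf v f t :=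
  mem_Vf.2 ⟨Or.inr ht, t, Or.inr ht, Up.refl t, Down.refl t⟩

lemma Vf_mono {x : V} (hx : R.below v x) : R.Vf x f t ⊆ R.Vf v f t := by
  have hsub : R.Ve x ⊆ R.Ve v := by
    rintro w (rfl | hw)
    · rcases hx.eq_or_par with h | h
      · exact Or.inl (by rw [h])
      · exact Or.inr h.2
    · exact Or.inr (hx.trans hw)
  intro w hw
  obtain ⟨h1, z, h2, h3⟩ := mem_Vf.1 hw
  exact mem_Vf.2 ⟨hsub h1, z, hsub h2, h3⟩

lemma Vf_anti (hff : ∀ x, f x ≤ f' x) : R.Vf v f' t ⊆ R.Vf v f t := by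
  intro w hw
  obtain ⟨h1, z, h2, h3, h4⟩ := mem_Vf.1 hw
  exact mem_Vf.2 ⟨h1, z, h2, h3.congr fun x _ _ _ => hff x, h4.congr fun x _ _ _ => hff x⟩

lemma mem_Vf_of_Up (hz : z ∈ R.Ve v) (h : R.Up f t z) : z ∈ R.Vf v f t :=
  mem_Vf.2 ⟨hz, z, hz, h, Down.refl z⟩

lemma mem_Vf_of_Down (hx : w ∈ R.Vf v f t) (hy : y ∈ R.Ve v) (h : R.Down f w y) :
    y ∈ R.Vf v f t := by
  obtain ⟨_, z, h2, h3, h4⟩ := mem_Vf.1 hx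
  exact mem_Vf.2 ⟨hy, z, h2, h3, h4.trans h⟩

/-- `V_f(t)` is closed under moving towards `t`, downwards. -/
lemma mem_Vf_towards (hw : w ∈ R.Vf v f t) (hwy : R.below w y)
    (hyt : R.below y t) (hy : y ∈ R.Ve v) : y ∈ R.Vf v f t := by
  obtain ⟨_, z, h2, h3, h4⟩ := mem_Vf.1 hw
  exact mem_Vf_of_Up hy (h3.mono_top (h4.1.trans hwy) hyt)

/-- `V_f(t)` is closed under moving towards `t`, upwards. -/
lemma par_mem_Vf (hv : v ≠ R.root) (hy : y ∈ R.Vf v f t) (hyv : R.below v y)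
    (hyt : ¬ R.below y t) : R.par y ∈ R.Vf v f t := by
  obtain ⟨_, z, h2, h3, h4⟩ := mem_Vf.1 hy
  have hzy : z ≠ y := fun h => hyt (h ▸ h3.1)
  have hyr := hyv.ne_root hv
  refine mem_Vf.2 ⟨?_, z, h2, h3, h4.mono_bot (h4.1.par_of_ne hzy) (par_below hyr)⟩
  rcases hyv.eq_or_par with h | h
  · exact Or.inl (by rw [h])
  · exact Or.inr h.2

lemma Vf_subset (hu : R.par v ∉ R.Vf v f t) (hw : w ∈ R.Vf v f t) : R.below v w := by
  rcases (mem_Vf.1 hw).1 with rfl | h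
  · exact absurd hw hu
  · exact h

lemma eq_cap_of_top (hv : v ≠ R.root) (hfe : R.Feasible v f) (hy : y ∈ R.Vf v f t)
    (hyv : R.below v y) (hp : R.par y ∉ R.Vf v f t) : f y = R.c y := by
  have hyt : R.below y t := by
    by_contra h
    exact hp (par_mem_Vf hv hy hyv h)
  have hpV : R.par y ∈ R.Ve v := by
    rcases hyv.eq_or_par with h | h
    · exact Or.inl (by rw [h])
    · exact Or.inr h.2
  by_contra hne
  have hle := hfe y hyv
  obtain ⟨_, z, h2, h3, h4⟩ := mem_Vf.1 hy
  exact hp (mem_Vf_of_Up hpV ((h3.mono_top h4.1 hyt).step (hyv.ne_root hv) (by omega)))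

lemma cap_le_of_bottom (hv : v ≠ R.root) (hy : R.par y ∈ R.Vf v f t)
    (hyv : R.below v y) (hp : y ∉ R.Vf v f t) : R.c y ≤ f y + 1 := by
  by_contra hne
  exact hp (mem_Vf_of_Down hy (Or.inr hyv) (Down.single (hyv.ne_root hv) (by omega)))

/-- A vertex reachable downwards from `par q` cannot lie in a set `V_f(t)` avoiding `par q`. -/
lemma par_mem_Vf_of_Down (hq : q ≠ R.root) (hqv : R.below v q)
    (hw : w ∈ R.Vf v f t)
    (hz : ∀ z, R.below z t → R.Up f t z → R.Down f z w → R.below q z)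
    (hD : R.Down f (R.par q) w) : R.par q ∈ R.Vf v f t := by
  obtain ⟨_, z, h2, h3, h4⟩ := mem_Vf.1 hw
  have hqz := hz z h3.1 h3 h4
  have hpV : R.par q ∈ R.Ve v := by
    rcases hqv.eq_or_par with h | h
    · exact Or.inl (by rw [h])
    · exact Or.inr h.2
  refine mem_Vf_of_Up hpV (h3.extend hq hqz fun x h5 h6 => ?_)
  have := hD.2 x ((par_below hq).trans h5) (h6.trans h4.1)
    (fun h => not_below_par hq (h ▸ h5))
  omega

end Reach

end RTI

namespace RTI

section Flow

variable {V : Type*} {R : RTI V} {f f' : V → ℕ} {v x y z w : V}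

/-- At every internal vertex of `I(e)`, the values of `f` on the three incident edges have even
sum and satisfy the triangle inequalities. -/
def Loc (R : RTI V) (v : V) (f : V → ℕ) : Prop :=
  ∀ x y z, R.below v x → R.Fork x y z → Even (f x + f y + f z) ∧ f x ≤ f y + f z ∧
    f y ≤ f x + f z

/-- The path between the two ends of the pair `p` uses the edge `(par w, w)`. -/
def Crosses (R : RTI V) (w : V) (p : Sym2 V) : Prop :=
  ∃ t t', p = s(t, t') ∧ R.onPath w t t'

lemma onPath_comm {t t' : V} : R.onPath w t t' ↔ R.onPath w t' t := by
  unfold onPath; tauto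

lemma crosses_mk {t t' : V} : R.Crosses w s(t, t') ↔ R.onPath w t t' := by
  constructor
  · rintro ⟨a, b, hab, h⟩
    rw [Sym2.eq_iff] at hab
    rcases hab with ⟨rfl, rfl⟩ | ⟨rfl, rfl⟩
    · exact h
    · exact onPath_comm.1 h
  · exact fun h => ⟨t, t', rfl, h⟩

lemma decomp_sum [Fintype V] {g : Sym2 V → ℕ} (hd : R.IsDecomp v f g) (hw : R.below v w) :
    f w = ∑ p : Sym2 V, if R.Crosses w p then g p else 0 := by
  rw [hd.2 w hw, finsum_mem_def, finsum_eq_sum_of_fintype]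
  refine Finset.sum_congr rfl fun p _ => ?_
  rw [Set.indicator_apply]
  exact if_congr Iff.rfl rfl rfl

lemma fork_below_iff {s : V} (hF : R.Fork x y z) (hvx : R.below v x) (hv : v ≠ R.root)
    (hs : s ∈ R.S v) : R.below x s ↔ (R.below y s ∨ R.below z s) := by
  constructor
  · intro h
    rcases hF.cases h with h1 | h1
    · subst h1
      rcases hs with rfl | hs
      · exact absurd hvx (not_below_par hv)
      · exact absurd hs.2 hF.not_leaf
    · exact h1
  · rintro (h | h)
    · exact hF.below_left.trans h
    · exact hF.below_right.trans h

lemma decomp_local [Fintype V] {g : Sym2 V → ℕ} (hv : v ≠ R.root) (hd : R.IsDecomp v f g)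
    (hvx : R.below v x) (hF : R.Fork x y z) :
    ∃ A B C, f x = A + B ∧ f y = A + C ∧ f z = B + C ∧
      ∀ p, R.Crosses x p → R.Crosses y p → g p ≤ A := by
  have key : ∀ p, g p ≠ 0 →
      (R.Crosses x p ∧ R.Crosses y p ∧ ¬ R.Crosses z p) ∨
      (R.Crosses x p ∧ ¬ R.Crosses y p ∧ R.Crosses z p) ∨
      (¬ R.Crosses x p ∧ R.Crosses y p ∧ R.Crosses z p) ∨
      (¬ R.Crosses x p ∧ ¬ R.Crosses y p ∧ ¬ R.Crosses z p) := by
    intro p hp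
    obtain ⟨t, t', ht, ht', -, rfl⟩ := hd.1 p hp
    have h1 := fork_below_iff hF hvx hv ht
    have h2 := fork_below_iff hF hvx hv ht'
    have h3 := fun a b => hF.not_both (w := t) a b
    have h4 := fun a b => hF.not_both (w := t') a b
    simp only [crosses_mk, onPath, h1, h2]
    by_cases a1 : R.below y t <;> by_cases a2 : R.below z t <;>
      by_cases a3 : R.below y t' <;> by_cases a4 : R.below z t' <;> simp_all
  refine ⟨∑ p, if R.Crosses x p ∧ R.Crosses y p then g p else 0,
    ∑ p, if R.Crosses x p ∧ R.Crosses z p then g p else 0,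
    ∑ p, if R.Crosses y p ∧ R.Crosses z p then g p else 0, ?_, ?_, ?_, ?_⟩
  · rw [decomp_sum hd hvx, ← Finset.sum_add_distrib]
    refine Finset.sum_congr rfl fun p _ => ?_
    by_cases hp : g p = 0
    · simp [hp]
    · rcases key p hp with h | h | h | h <;> simp [h]
  · rw [decomp_sum hd (hvx.trans hF.below_left), ← Finset.sum_add_distrib]
    refine Finset.sum_congr rfl fun p _ => ?_
    by_cases hp : g p = 0
    · simp [hp]
    · rcases key p hp with h | h | h | h <;> simp [h]
  · rw [decomp_sum hd (hvx.trans hF.below_right), ← Finset.sum_add_distrib]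
    refine Finset.sum_congr rfl fun p _ => ?_
    by_cases hp : g p = 0
    · simp [hp]
    · rcases key p hp with h | h | h | h <;> simp [h]
  · intro p hx hy
    have := Finset.single_le_sum
      (f := fun p => if R.Crosses x p ∧ R.Crosses y p then g p else 0)
      (fun i _ => Nat.zero_le _) (Finset.mem_univ p)
    simpa [hx, hy] using this

lemma IsFlow.loc [Fintype V] (hv : v ≠ R.root) (h : R.IsFlow v f) : R.Loc v f := by
  obtain ⟨g, hg⟩ := h
  intro x y z hvx hF
  obtain ⟨A, B, C, h1, h2, h3, -⟩ := decomp_local hv hg hvx hF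
  refine ⟨⟨A + B + C, by omega⟩, by omega, by omega⟩

lemma Loc.mono (h : R.Loc v f) (hx : R.below v x) : R.Loc x f :=
  fun a b c ha => h a b c (hx.trans ha)

/-- Path packing in list form: `O` lists the lower ends of the paths leaving `I(e)` through its
top terminal and `P` lists the end pairs of the remaining paths. -/
structure ListDecomp (R : RTI V) (x : V) (f : V → ℕ) (O : List V) (P : List (V × V)) :
    Prop where
  mem_open : ∀ s ∈ O, s ∈ R.Te x
  mem_closed : ∀ p ∈ P, p.1 ∈ R.Te x ∧ p.2 ∈ R.Te x ∧ p.1 ≠ p.2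
  length_open : O.length = f x
  count : ∀ w, R.below x w →
    f w = O.countP (fun s => R.below w s) + P.countP (fun p => R.onPath w p.1 p.2)

lemma countP_zip_left {α β : Type*} (p : α → Bool) (l : List α) (l' : List β)
    (h : l.length = l'.length) : (l.zip l').countP (fun q => p q.1) = l.countP p := by
  conv_rhs => rw [← List.map_fst_zip h.le, List.countP_map]
  rfl

lemma countP_zip_right {α β : Type*} (p : β → Bool) (l : List α) (l' : List β)
    (h : l.length = l'.length) : (l.zip l').countP (fun q => p q.2) = l'.countP p := by
  conv_rhs => rw [← List.map_snd_zip h.ge, List.countP_map]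
  rfl

lemma countP_eq_zero' {α : Type*} {p : α → Prop} {l : List α} (h : ∀ a ∈ l, ¬ p a) :
    l.countP (fun a => p a) = 0 := by
  rw [List.countP_eq_zero]
  intro a ha
  simpa using h a ha

lemma ListDecomp.combine {Oy Oz : List V} {Py Pz : List (V × V)} (hF : R.Fork x y z)
    (hy : R.ListDecomp y f Oy Py) (hz : R.ListDecomp z f Oz Pz)
    (he : Even (f x + f y + f z)) (h1 : f x ≤ f y + f z) (h2 : f y ≤ f x + f z)
    (h3 : f z ≤ f x + f y) : ∃ O P, R.ListDecomp x f O P := by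
  obtain ⟨A, B, C, hA, hB, hC⟩ : ∃ A B C, f x = A + B ∧ f y = A + C ∧ f z = B + C := by
    obtain ⟨k, hk⟩ := he
    exact ⟨k - f z, k - f y, k - f x, by omega, by omega, by omega⟩
  have hly := hy.length_open
  have hlz := hz.length_open
  have hlen : (Oy.drop A).length = (Oz.drop B).length := by simp; omega
  have hTy : ∀ s, s ∈ R.Te y → s ∈ R.Te x := fun s hs => ⟨hF.below_left.trans hs.1, hs.2⟩
  have hTz : ∀ s, s ∈ R.Te z → s ∈ R.Te x := fun s hs => ⟨hF.below_right.trans hs.1, hs.2⟩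
  have hzip : ∀ p ∈ (Oy.drop A).zip (Oz.drop B), p.1 ∈ R.Te y ∧ p.2 ∈ R.Te z := by
    rintro ⟨a, b⟩ hp
    have := List.of_mem_zip hp
    exact ⟨hy.mem_open a (List.mem_of_mem_drop this.1), hz.mem_open b (List.mem_of_mem_drop this.2)⟩
  have hcl : ∀ p ∈ Py ++ Pz ++ (Oy.drop A).zip (Oz.drop B),
      p.1 ∈ R.Te x ∧ p.2 ∈ R.Te x ∧ p.1 ≠ p.2 := by
    intro p hp
    simp only [List.mem_append] at hp
    rcases hp with (hp | hp) | hp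
    · have := hy.mem_closed p hp
      exact ⟨hTy _ this.1, hTy _ this.2.1, this.2.2⟩
    · have := hz.mem_closed p hp
      exact ⟨hTz _ this.1, hTz _ this.2.1, this.2.2⟩
    · have := hzip p hp
      refine ⟨hTy _ this.1, hTz _ this.2, fun h => ?_⟩
      exact hF.not_both this.1.1 (h ▸ this.2.1)
  have hop : ∀ s ∈ Oy.take A ++ Oz.take B, s ∈ R.Te x := by
    intro s hs
    rcases List.mem_append.1 hs with hs | hs
    · exact hTy _ (hy.mem_open s (List.mem_of_mem_take hs))
    · exact hTz _ (hz.mem_open s (List.mem_of_mem_take hs))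
  have hol : (Oy.take A ++ Oz.take B).length = f x := by simp; omega
  refine ⟨Oy.take A ++ Oz.take B, Py ++ Pz ++ (Oy.drop A).zip (Oz.drop B),
    hop, hcl, hol, fun w hw => ?_⟩
  rcases hF.cases hw with rfl | hw | hw
  · rw [countP_eq_zero' (l := Py ++ Pz ++ _), add_zero, List.countP_eq_length.2, hol]
    · intro s hs
      simpa using (hop s hs).1
    · intro p hp
      have := hcl p hp
      have h1 := this.1.1
      have h2 := this.2.1.1
      unfold onPath
      tauto
  · have hn : ∀ s ∈ R.Te z, ¬ R.below w s := fun s hs h => hF.not_both (hw.trans h) hs.1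
    rw [List.countP_append, List.countP_append, List.countP_append,
      countP_eq_zero' (l := Oz.take B) (fun s hs => hn s (hz.mem_open s (List.mem_of_mem_take hs))),
      countP_eq_zero' (l := Pz) (fun p hp h => by
        have := hz.mem_closed p hp
        have h1 := hn _ this.1
        have h2 := hn _ this.2.1
        unfold onPath at h
        tauto)]
    have : ((Oy.drop A).zip (Oz.drop B)).countP (fun p => R.onPath w p.1 p.2)
        = (Oy.drop A).countP (fun s => R.below w s) := by
      rw [← countP_zip_left _ _ _ hlen]
      refine List.countP_congr fun p hp => ?_
      have := hn _ (hzip p hp).2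
      simp [onPath, this]
    rw [this, hy.count w hw]
    conv_lhs => rw [← List.take_append_drop A Oy, List.countP_append]
    omega
  · have hn : ∀ s ∈ R.Te y, ¬ R.below w s := fun s hs h => hF.not_both hs.1 (hw.trans h)
    rw [List.countP_append, List.countP_append, List.countP_append,
      countP_eq_zero' (l := Oy.take A) (fun s hs => hn s (hy.mem_open s (List.mem_of_mem_take hs))),
      countP_eq_zero' (l := Py) (fun p hp h => by
        have := hy.mem_closed p hp
        have h1 := hn _ this.1
        have h2 := hn _ this.2.1
        unfold onPath at h
        tauto)]
    have : ((Oy.drop A).zip (Oz.drop B)).countP (fun p => R.onPath w p.1 p.2)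
        = (Oz.drop B).countP (fun s => R.below w s) := by
      rw [← countP_zip_right _ _ _ hlen]
      refine List.countP_congr fun p hp => ?_
      have := hn _ (hzip p hp).1
      simp [onPath, this]
    rw [this, hz.count w hw]
    conv_lhs => rw [← List.take_append_drop B Oz, List.countP_append]
    omega

lemma Loc.exists_listDecomp [Finite V] (hv : v ≠ R.root) (h : R.Loc v f) :
    ∃ O P, R.ListDecomp v f O P := by
  obtain ⟨N, hN⟩ : ∃ N, ∀ x, R.dep x ≤ N := by
    obtain ⟨N, hN⟩ := (Set.finite_range R.dep).bddAbove
    exact ⟨N, fun x => hN ⟨x, rfl⟩⟩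
  suffices ∀ n x, N - R.dep x ≤ n → x ≠ R.root → R.Loc x f → ∃ O P, R.ListDecomp x f O P from
    this _ v le_rfl hv h
  intro n
  induction n with
  | zero =>
    intro x hx hxr hl
    rcases leaf_or_children hxr with hleaf | ⟨y, z, h1, h2⟩
    · refine ⟨List.replicate (f x) x, [], ?_, by simp, by simp, ?_⟩
      · intro s hs
        rw [List.eq_of_mem_replicate hs]
        exact ⟨below_refl x, hleaf⟩
      · intro w hw
        rw [hleaf.eq_of_below hw]
        simp [List.countP_replicate, below_refl]
    · have hF : R.Fork x y z := ⟨h1, h2⟩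
      have := R.dep_par y hF.left_ne_root
      rw [hF.par_left] at this
      have := hN y
      omega
  | succ n ih =>
    intro x hx hxr hl
    rcases leaf_or_children hxr with hleaf | ⟨y, z, h1, h2⟩
    · refine ⟨List.replicate (f x) x, [], ?_, by simp, by simp, ?_⟩
      · intro s hs
        rw [List.eq_of_mem_replicate hs]
        exact ⟨below_refl x, hleaf⟩
      · intro w hw
        rw [hleaf.eq_of_below hw]
        simp [List.countP_replicate, below_refl]
    · have hF : R.Fork x y z := ⟨h1, h2⟩
      have e1 := R.dep_par y hF.left_ne_root
      rw [hF.par_left] at e1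
      have e2 := R.dep_par z hF.right_ne_root
      rw [hF.par_right] at e2
      obtain ⟨Oy, Py, hy⟩ := ih y (by omega) hF.left_ne_root (hl.mono hF.below_left)
      obtain ⟨Oz, Pz, hz⟩ := ih z (by omega) hF.right_ne_root (hl.mono hF.below_right)
      obtain ⟨h3, h4, h5⟩ := hl x y z (below_refl x) hF
      obtain ⟨-, -, h6⟩ := hl x z y (below_refl x) hF.symm
      exact hy.combine hF hz h3 h4 h5 h6

lemma sum_count_eq_countP {α : Type*} [Fintype α] [DecidableEq α] (p : α → Prop) (l : List α) :
    (∑ a : α, if p a then l.count a else 0) = l.countP (fun a => p a) := by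
  induction l with
  | nil => simp
  | cons b l ih =>
    rw [List.countP_cons, ← ih]
    have : ∀ a, (if p a then (b :: l).count a else 0)
        = (if p a then l.count a else 0) + (if a = b then (if p b then 1 else 0) else 0) := by
      intro a
      rw [List.count_cons]
      by_cases hab : a = b
      · subst hab
        by_cases hp : p a <;> simp [hp]
      · have : b ≠ a := fun h => hab h.symm
        simp [hab, this]
    simp_rw [this]
    rw [Finset.sum_add_distrib, Finset.sum_ite_eq' Finset.univ b]
    simp

lemma Loc.isFlow [Fintype V] (hv : v ≠ R.root) (h : R.Loc v f) : R.IsFlow v f := by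
  obtain ⟨O, P, hd⟩ := h.exists_listDecomp hv
  let L : List (Sym2 V) := O.map (fun s => s(R.par v, s)) ++ P.map (fun p => s(p.1, p.2))
  refine ⟨fun p => L.count p, ?_, fun w hw => ?_⟩
  · intro p hp
    have hp : p ∈ L := List.count_pos_iff.1 (Nat.pos_of_ne_zero hp)
    rcases List.mem_append.1 hp with hp | hp
    · obtain ⟨s, hs, rfl⟩ := List.mem_map.1 hp
      have := hd.mem_open s hs
      exact ⟨R.par v, s, Or.inl rfl, Or.inr this, fun h => not_below_par hv (h ▸ this.1), rfl⟩
    · obtain ⟨q, hq, rfl⟩ := List.mem_map.1 hp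
      have := hd.mem_closed q hq
      exact ⟨q.1, q.2, Or.inr this.1, Or.inr this.2.1, this.2.2, rfl⟩
  · rw [finsum_mem_def, finsum_eq_sum_of_fintype]
    have : ∀ p, Set.indicator {p : Sym2 V | ∃ t t', p = s(t, t') ∧ R.onPath w t t'}
        (fun p => L.count p) p = if R.Crosses w p then L.count p else 0 := by
      intro p
      rw [Set.indicator_apply]
      exact if_congr Iff.rfl rfl rfl
    rw [Finset.sum_congr rfl fun p _ => this p, sum_count_eq_countP, hd.count w hw,
      List.countP_append, List.countP_map, List.countP_map]
    have hwu : ¬ R.below w (R.par v) := fun h => not_below_par hv (hw.trans h)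
    congr 1
    · refine List.countP_congr fun s _ => ?_
      simp [crosses_mk, onPath, hwu]
    · refine List.countP_congr fun s _ => ?_
      simp [crosses_mk]

end Flow

end RTI

namespace RTI

section Cuts

variable {V : Type*} {R : RTI V} {f f' : V → ℕ} {v x y z w t : V} {X W A : Set V}

lemma hval_eq_sum [Fintype V] (h : V → ℕ) :
    R.hval v X h = ∑ e : V, if e ∈ R.cutE v X then h e else 0 := by
  rw [hval, finsum_mem_def, finsum_eq_sum_of_fintype]
  refine Finset.sum_congr rfl fun e _ => ?_
  rw [Set.indicator_apply]

/-- The total value of `f` on the edges incident to a non-root vertex `x`. -/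
noncomputable def inc [Fintype V] (R : RTI V) (f : V → ℕ) (x : V) : ℕ :=
  f x + ∑ e : V, if e ∈ R.children x then f e else 0

lemma sum_children_leaf [Fintype V] (hx : R.leaf x) (g : V → ℕ) :
    (∑ e : V, if e ∈ R.children x then g e else 0) = 0 :=
  Finset.sum_eq_zero fun e _ => if_neg fun h => hx.2 e h.2 h.1

lemma Fork.sum_children [Fintype V] (hF : R.Fork x y z) (g : V → ℕ) :
    (∑ e : V, if e ∈ R.children x then g e else 0) = g y + g z := by
  have h : ∀ e, (if e ∈ R.children x then g e else 0)
      = (if e = y then g y else 0) + (if e = z then g z else 0) := by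
    intro e
    have hne := hF.ne
    rw [hF.children_eq]
    by_cases h1 : e = y
    · subst h1
      simp [hne]
    · by_cases h2 : e = z
      · subst h2
        simp [h1]
      · simp [h1, h2]
  simp_rw [h]
  rw [Finset.sum_add_distrib, Finset.sum_ite_eq', Finset.sum_ite_eq']
  simp

lemma sum_sum_children [Fintype V] (X : Set V) (g : V → ℕ) :
    (∑ x : V, if x ∈ X then (∑ e : V, if e ∈ R.children x then g e else 0) else 0)
      = ∑ e : V, if e ≠ R.root ∧ R.par e ∈ X then g e else 0 := by
  have : ∀ x, (if x ∈ X then (∑ e : V, if e ∈ R.children x then g e else 0) else 0)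
      = ∑ e : V, if R.par e = x then (if e ≠ R.root ∧ R.par e ∈ X then g e else 0) else 0 := by
    intro x
    by_cases hx : x ∈ X
    · rw [if_pos hx]
      refine Finset.sum_congr rfl fun e _ => ?_
      by_cases he : R.par e = x
      · subst he
        by_cases hr : e = R.root <;> simp [children, hr, hx]
      · simp [children, he]
    · rw [if_neg hx]
      symm
      refine Finset.sum_eq_zero fun e _ => ?_
      by_cases he : R.par e = x
      · subst he
        simp [hx]
      · simp [he]
  simp_rw [this]
  rw [Finset.sum_comm]
  refine Finset.sum_congr rfl fun e _ => ?_
  rw [Finset.sum_ite_eq]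
  simp

lemma below_of_par_mem (hX : ∀ x ∈ X, R.below v x) (hy : y ≠ R.root) (h : R.par y ∈ X) :
    R.below v y := (hX _ h).trans (par_below hy)

/-- Handshake identity for the edges incident to `X`. -/
lemma sum_inc [Fintype V] (hv : v ≠ R.root) (hX : ∀ x ∈ X, R.below v x) (f : V → ℕ) :
    (∑ x : V, if x ∈ X then R.inc f x else 0)
      = R.hval v X f + 2 * ∑ e : V, if e ∈ X ∧ R.par e ∈ X then f e else 0 := by
  have h1 : ∀ x, (if x ∈ X then R.inc f x else 0) = (if x ∈ X then f x else 0)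
      + (if x ∈ X then (∑ e : V, if e ∈ R.children x then f e else 0) else 0) := by
    intro x
    by_cases hx : x ∈ X <;> simp [hx, inc]
  simp_rw [h1]
  rw [Finset.sum_add_distrib, sum_sum_children, hval_eq_sum, Finset.mul_sum,
    ← Finset.sum_add_distrib, ← Finset.sum_add_distrib]
  refine Finset.sum_congr rfl fun e _ => ?_
  by_cases he : e ∈ X
  · have h2 := hX e he
    have h3 := h2.ne_root hv
    by_cases hp : R.par e ∈ X <;> simp [he, hp, h2, h3, cutE]
    omega
  · by_cases hp : R.par e ∈ X
    · by_cases hr : e = R.root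
      · subst hr
        rw [R.par_root] at hp
        exact absurd hp he
      · simp [he, hp, hr, cutE, below_of_par_mem hX hr hp]
    · simp [he, hp, cutE]

lemma Loc.even_hval [Fintype V] (hv : v ≠ R.root) (hl : R.Loc v f)
    (hW : ∀ x ∈ W, R.below v x) (hnl : ∀ x ∈ W, ¬ R.leaf x) : Even (R.hval v W f) := by
  have h1 := sum_inc hv hW f
  have h2 : Even (∑ x : V, if x ∈ W then R.inc f x else 0) := by
    refine Finset.even_sum _ fun x _ => ?_
    by_cases hx : x ∈ W
    · rw [if_pos hx]
      rcases leaf_or_children ((hW x hx).ne_root hv) with h | ⟨y, z, h3, h4⟩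
      · exact absurd h (hnl x hx)
      · have hF : R.Fork x y z := ⟨h3, h4⟩
        rw [inc, hF.sum_children, ← add_assoc]
        exact (hl x y z (hW x hx) hF).1
    · simp [hx]
  rw [h1, Nat.even_add] at h2
  exact h2.2 (even_two_mul _)

/-- `f` is balanced on `X`: at each vertex of `X` other than `t`, the edge towards `t` carries
as much as the two other edges together. -/
def Bal (R : RTI V) (f : V → ℕ) (X : Set V) (t : V) : Prop :=
  ∀ x ∈ X, x ≠ t → ∀ y z, R.Fork x y z →
    (R.below y t → f y = f x + f z) ∧ (¬ R.below x t → f x = f y + f z)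

/-- The value of `f` on the edge leaving `x` towards `t`, and `0` if `x` is the leaf `t`. -/
noncomputable def towards [Fintype V] (R : RTI V) (f : V → ℕ) (t x : V) : ℕ :=
  if R.below x t then (∑ e : V, if e ∈ R.children x then (if R.below e t then f e else 0) else 0)
  else f x

lemma Fork.towards_left [Fintype V] (hF : R.Fork x y z) (h : R.below y t) :
    R.towards f t x = f y := by
  have : ¬ R.below z t := fun h' => hF.not_both h h'
  rw [towards, if_pos (hF.below_left.trans h), hF.sum_children]
  simp [h, this]

lemma sum_towards [Fintype V] (hv : v ≠ R.root) (hX : ∀ x ∈ X, R.below v x)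
    (hX1 : ∀ e, e ≠ R.root → R.below e t → R.par e ∈ X → e ∈ X)
    (hX2 : ∀ e ∈ X, ¬ R.below e t → R.par e ∈ X) :
    (∑ x : V, if x ∈ X then R.towards f t x else 0)
      = ∑ e : V, if e ∈ X ∧ R.par e ∈ X then f e else 0 := by
  have h1 : ∀ x, (if x ∈ X then R.towards f t x else 0)
      = (if x ∈ X ∧ ¬ R.below x t then f x else 0)
      + (if x ∈ X then (∑ e : V, if e ∈ R.children x then
          (if R.below e t then f e else 0) else 0) else 0) := by
    intro x
    by_cases hx : x ∈ X
    · by_cases hb : R.below x t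
      · simp [hx, hb, towards]
      · have : (∑ e : V, if e ∈ R.children x then (if R.below e t then f e else 0) else 0) = 0 := by
          refine Finset.sum_eq_zero fun e _ => ?_
          by_cases he : e ∈ R.children x
          · have : ¬ R.below e t := fun h => hb ((he.1 ▸ par_below he.2).trans h)
            simp [this]
          · simp [he]
        rw [this]
        simp [hx, hb, towards]
    · simp [hx]
  simp_rw [h1]
  rw [Finset.sum_add_distrib, sum_sum_children, ← Finset.sum_add_distrib]
  refine Finset.sum_congr rfl fun e _ => ?_
  by_cases he : e ∈ X
  · have h3 := (hX e he).ne_root hv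
    by_cases hb : R.below e t
    · simp [he, hb, h3]
    · simp [he, hb, hX2 e he hb]
  · by_cases hb : R.below e t
    · by_cases hr : e = R.root
      · have hr' : R.root ∉ X := hr ▸ he
        simp [hr, hr', R.par_root]
      · have : R.par e ∉ X := fun h => he (hX1 e hr hb h)
        simp [he, this]
    · simp [he, hb]

/-- The capacity used around a subtree `X` containing the single terminal `t` equals `f(e_t)`
exactly when `f` is balanced on `X`. -/
lemma hval_eq_iff_bal [Fintype V] (hv : v ≠ R.root) (hl : R.Loc v f)
    (hX : ∀ x ∈ X, R.below v x) (hX1 : ∀ e, e ≠ R.root → R.below e t → R.par e ∈ X → e ∈ X)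
    (hX2 : ∀ e ∈ X, ¬ R.below e t → R.par e ∈ X) (ht : R.leaf t) (htX : t ∈ X)
    (hXl : ∀ x ∈ X, R.leaf x → x = t) : f t = R.hval v X f ↔ R.Bal f X t := by
  have h1 := sum_inc hv hX f
  rw [← sum_towards hv hX hX1 hX2] at h1
  have hpt : ∀ x, (if x ∈ X then 2 * R.towards f t x else 0) + (if x = t then f t else 0)
      ≤ (if x ∈ X then R.inc f x else 0) := by
    intro x
    by_cases hxt : x = t
    · subst hxt
      simp [htX, inc, towards, below_refl, sum_children_leaf ht]
    · by_cases hx : x ∈ X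
      · rcases leaf_or_children ((hX x hx).ne_root hv) with h | ⟨y, z, h3, h4⟩
        · exact absurd (hXl x hx h) hxt
        · have hF : R.Fork x y z := ⟨h3, h4⟩
          simp only [hx, hxt, if_true, if_false, add_zero, inc, hF.sum_children]
          have e1 := hl x y z (hX x hx) hF
          have e2 := hl x z y (hX x hx) hF.symm
          by_cases hb : R.below x t
          · rcases hF.cases hb with h | h | h
            · exact absurd h.symm hxt
            · rw [hF.towards_left h]; omega
            · rw [hF.symm.towards_left h]; omega
          · rw [towards, if_neg hb]; omega
      · simp [hx, hxt]
  have hiff := Finset.sum_eq_sum_iff_of_le (s := Finset.univ) fun x _ => hpt x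
  rw [Finset.sum_add_distrib, Finset.sum_ite_eq' Finset.univ t, h1] at hiff
  have h2 : (∑ x : V, if x ∈ X then 2 * R.towards f t x else 0)
      = 2 * ∑ x : V, if x ∈ X then R.towards f t x else 0 := by
    rw [Finset.mul_sum]
    refine Finset.sum_congr rfl fun x _ => ?_
    by_cases hx : x ∈ X <;> simp [hx]
  rw [h2] at hiff
  simp only [Finset.mem_univ, if_true, true_imp_iff] at hiff
  have h3 : f t = R.hval v X f ↔ ∀ x, (if x ∈ X then 2 * R.towards f t x else 0)
      + (if x = t then f t else 0) = (if x ∈ X then R.inc f x else 0) := by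
    rw [← hiff]
    omega
  rw [h3]
  constructor
  · intro h x hx hxt y z hF
    have h4 := h x
    simp only [hx, hxt, if_true, if_false, add_zero, inc, hF.sum_children] at h4
    constructor
    · intro hb
      rw [hF.towards_left hb] at h4
      omega
    · intro hb
      rw [towards, if_neg hb] at h4
      omega
  · intro h x
    by_cases hxt : x = t
    · subst hxt
      simp [htX, inc, towards, below_refl, sum_children_leaf ht]
    · by_cases hx : x ∈ X
      · rcases leaf_or_children ((hX x hx).ne_root hv) with h' | ⟨y, z, h5, h6⟩
        · exact absurd (hXl x hx h') hxt
        · have hF : R.Fork x y z := ⟨h5, h6⟩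
          simp only [hx, hxt, if_true, if_false, add_zero, inc, hF.sum_children]
          by_cases hb : R.below x t
          · rcases hF.cases hb with h' | h' | h'
            · exact absurd h'.symm hxt
            · rw [hF.towards_left h']
              have := (h x hx hxt y z hF).1 h'
              omega
            · rw [hF.symm.towards_left h']
              have := (h x hx hxt z y hF.symm).1 h'
              omega
          · rw [towards, if_neg hb]
            have := (h x hx hxt y z hF).2 hb
            omega
      · simp [hx, hxt]

/-- The vertices reachable downwards from `y` inside `A`. -/
def descComp (R : RTI V) (A : Set V) (y : V) : Set V :=
  {w | R.below y w ∧ ∀ x, R.below y x → R.below x w → x ∈ A}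

lemma descComp_isComp (hv : v ≠ R.root) (hyA : y ∈ A)
    (hp : R.par y ∉ A) : R.IsComp v A (R.descComp A y) := by
  refine ⟨⟨y, below_refl y, fun x h1 h2 => h2.antisymm h1 ▸ hyA⟩,
    fun w hw => hw.2 w hw.1 (below_refl w), ?_, ?_, ?_⟩
  · rintro w₁ ⟨h1, h1'⟩ w₂ ⟨h2, h2'⟩ x ⟨hx, hx'⟩
    refine ⟨hx' y h1 h2, fun x' h3 h4 => ?_⟩
    rcases hx with hx | hx
    · exact h1' x' h3 (h4.trans hx)
    · exact h2' x' h3 (h4.trans hx)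
  · rintro x hvx ⟨h1, h2⟩ h3
    have hne : y ≠ x := fun h => hp (h ▸ h3)
    exact ⟨h1.par_of_ne hne,
      fun x' h4 h5 => h2 x' h4 (h5.trans (par_below (hvx.ne_root hv)))⟩
  · rintro x hvx ⟨h1, h2⟩ h3
    refine ⟨h1.trans (par_below (hvx.ne_root hv)), fun x' h4 h5 => ?_⟩
    rcases h5.eq_or_par with rfl | ⟨_, h5⟩
    · exact h3
    · exact h2 x' h4 h5

lemma IsComp.eq_descComp (hv : v ≠ R.root) (hW : R.IsComp v A W) (hy : R.below v y)
    (hyW : y ∈ W) (hp : R.par y ∉ W) : W = R.descComp A y := by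
  obtain ⟨-, hWA, hconn, -, hdown⟩ := hW
  have hyr := hy.ne_root hv
  apply Set.Subset.antisymm
  · intro w hw
    have hyw : R.below y w := by
      by_contra hn
      refine hp (hconn y hyW w hw _ ⟨Or.inl (par_below hyr), fun z h1 h2 => ?_⟩)
      exact h1.par_of_ne fun h => hn (h ▸ h2)
    refine ⟨hyw, fun x h1 h2 => hWA (hconn y hyW w hw x ⟨Or.inr h2, fun z h3 _ => h3.trans h1⟩)⟩
  · rintro w ⟨h1, h2⟩
    induction h1 with
    | refl => exact hyW
    | tail hbc hcd ih =>
      rename_i b d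
      have hyb : R.below y b := hbc
      have hbd : R.below b d := Relation.ReflTransGen.single hcd
      have hb := ih fun x h3 h4 => h2 x h3 (h4.trans hbd)
      exact hdown d (hy.trans (hyb.trans hbd)) (hcd.1.symm ▸ hb)
        (h2 d (hyb.trans hbd) (below_refl d))

end Cuts

section Blocking

variable {V : Type*} {R : RTI V} {f f' : V → ℕ} {v x y z w t : V}

/-- Local form of the definition of a blocking flow. -/
structure Blk (R : RTI V) (v : V) (f : V → ℕ) : Prop where
  loc : R.Loc v f
  feasible : R.Feasible v f
  avoid : ∀ t ∈ R.Te v, R.par v ∉ R.Vf v f t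
  disjoint : ∀ t ∈ R.Te v, ∀ t' ∈ R.Te v, ∀ x ∈ R.Vf v f t, x ∈ R.Vf v f t' → t = t'
  bal : ∀ t ∈ R.Te v, R.Bal f (R.Vf v f t) t

lemma bal_iff [Fintype V] (hv : v ≠ R.root) (hl : R.Loc v f)
    (ha : ∀ t ∈ R.Te v, R.par v ∉ R.Vf v f t)
    (hd : ∀ t ∈ R.Te v, ∀ t' ∈ R.Te v, ∀ x ∈ R.Vf v f t, x ∈ R.Vf v f t' → t = t')
    (ht : t ∈ R.Te v) : f t = R.hval v (R.Vf v f t) f ↔ R.Bal f (R.Vf v f t) t := by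
  have hX : ∀ x ∈ R.Vf v f t, R.below v x := fun x hx => Vf_subset (ha t ht) hx
  refine hval_eq_iff_bal hv hl hX ?_ ?_ ht.2 (self_mem_Vf ht.1) ?_
  · intro e he het hp
    exact mem_Vf_towards hp (par_below he) het (Or.inr (below_of_par_mem hX he hp))
  · intro e he het
    exact par_mem_Vf hv he (hX e he) het
  · intro x hx hxl
    have := hX x hx
    exact hd x ⟨this, hxl⟩ t ht x (self_mem_Vf this) hx

lemma hval_descComp [Fintype V] (hv : v ≠ R.root) (hl : R.Loc v f) (hfe : R.Feasible v f)
    (hy : R.below v y) (hp : R.par y ∈ R.UT v f) (hyU : y ∉ R.UT v f) :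
    Odd (R.hval v (R.descComp (R.Ve v \ R.UT v f) y) R.c) ↔ Odd (R.c y - f y) := by
  set A := R.Ve v \ R.UT v f with hA
  set W := R.descComp A y with hWd
  have hyA : y ∈ A := ⟨Or.inr hy, hyU⟩
  have hpA : R.par y ∉ A := fun h => h.2 hp
  have hC : R.IsComp v A W := descComp_isComp hv hyA hpA
  have hWb : ∀ x ∈ W, R.below v x := fun x hx => hy.trans hx.1
  have hev : Even (R.hval v W f) := by
    refine hl.even_hval hv hWb fun x hx hxl => (hC.2.1 hx).2 ?_
    exact Set.mem_biUnion (show x ∈ R.Te v from ⟨hWb x hx, hxl⟩) (self_mem_Vf (hWb x hx))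
  have hcut : ∀ e ∈ R.cutE v W, R.c e = f e + if e = y then R.c y - f y else 0 := by
    intro e he
    by_cases hey : e = y
    · subst hey
      have := hfe e hy
      simp; omega
    · simp only [hey, if_false, add_zero]
      obtain ⟨hve, hx⟩ := he
      have hpe : R.par e ∈ W := by
        by_contra hpe
        have heW : e ∈ W := by tauto
        refine hpe ⟨heW.1.par_of_ne (fun h => hey h.symm), fun x' h4 h5 => ?_⟩
        exact heW.2 x' h4 (h5.trans (par_below (hve.ne_root hv)))
      have heW : e ∉ W := by tauto
      have heU : e ∈ R.UT v f := by
        by_contra h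
        exact heW (hC.2.2.2.2 e hve hpe ⟨Or.inr hve, h⟩)
      obtain ⟨t, ht, het⟩ := Set.mem_iUnion₂.1 heU
      refine (eq_cap_of_top hv hfe het hve fun h => ?_).symm
      exact (hC.2.1 hpe).2 (Set.mem_biUnion ht h)
  have hyW : y ∈ W := ⟨below_refl y, fun x h1 h2 => h2.antisymm h1 ▸ hyA⟩
  have hpW : R.par y ∉ W := fun h => hpA (hC.2.1 h)
  have hyc : y ∈ R.cutE v W := ⟨hy, by tauto⟩
  have hsum : R.hval v W R.c = R.hval v W f + (R.c y - f y) := by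
    rw [hval_eq_sum, hval_eq_sum]
    have : ∀ e, (if e ∈ R.cutE v W then R.c e else 0)
        = (if e ∈ R.cutE v W then f e else 0) + (if e = y then R.c y - f y else 0) := by
      intro e
      by_cases he : e ∈ R.cutE v W
      · simp only [he, if_true]
        exact hcut e he
      · have : e ≠ y := fun h => he (h ▸ hyc)
        simp [he, this]
    simp_rw [this]
    rw [Finset.sum_add_distrib, Finset.sum_ite_eq' Finset.univ y]
    simp
  rw [hsum, Nat.odd_add, ← Nat.not_even_iff_odd, ← Nat.not_even_iff_odd]
  tauto

/-- The number of odd components attached below `V_f(t)` makes up for the residual capacity of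
the cut around `V_f(t)`. -/
lemma hval_add_odd [Fintype V] (hv : v ≠ R.root) (hl : R.Loc v f) (hfe : R.Feasible v f)
    (ha : ∀ t ∈ R.Te v, R.par v ∉ R.Vf v f t)
    (hd : ∀ t ∈ R.Te v, ∀ t' ∈ R.Te v, ∀ x ∈ R.Vf v f t, x ∈ R.Vf v f t' → t = t')
    (ht : t ∈ R.Te v) :
    R.hval v (R.Vf v f t) f + (R.oddOf v (R.UT v f) (R.Vf v f t)).ncard
      = R.hval v (R.Vf v f t) R.c := by
  set X := R.Vf v f t with hXd
  set A := R.Ve v \ R.UT v f with hA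
  have hX : ∀ x ∈ X, R.below v x := fun x hx => Vf_subset (ha t ht) hx
  have hXU : X ⊆ R.UT v f := fun x hx => Set.mem_biUnion ht hx
  have htop : ∀ e, R.below v e → e ∈ X → R.par e ∉ X → f e = R.c e :=
    fun e h1 h2 h3 => eq_cap_of_top hv hfe h2 h1 h3
  have hbot : ∀ e, R.below v e → e ∉ X → R.par e ∈ X → R.c e ≤ f e + 1 :=
    fun e h1 h2 h3 => cap_le_of_bottom hv h3 h1 h2
  set Y : Set V := {e | e ∈ R.cutE v X ∧ f e + 1 = R.c e} with hY
  have hYp : ∀ e ∈ Y, R.below v e ∧ R.par e ∈ X ∧ e ∉ R.UT v f := by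
    rintro e ⟨⟨h1, h2⟩, h3⟩
    have hp : R.par e ∈ X := by
      by_contra hp
      have := htop e h1 (by tauto) hp
      omega
    refine ⟨h1, hp, fun heU => ?_⟩
    obtain ⟨t', ht', het⟩ := Set.mem_iUnion₂.1 heU
    have hpt : R.par e ∉ R.Vf v f t' := by
      intro h
      have := hd t ht t' ht' _ hp h
      subst this
      exact h2 ⟨fun _ => hp, fun _ => het⟩
    have := eq_cap_of_top hv hfe het h1 hpt
    omega
  have himg : R.oddOf v (R.UT v f) X = R.descComp A '' Y := by
    ext W
    constructor
    · rintro ⟨hC, hodd, y, hyW, hpW, hpX⟩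
      have hyV := hC.2.1 hyW
      have hyr : y ≠ R.root := by
        rintro rfl
        rw [R.par_root] at hpW
        exact hpW hyW
      have hvy := below_of_par_mem hX hyr hpX
      have hyX : y ∉ X := fun h => hyV.2 (hXU h)
      have hWe := hC.eq_descComp hv hvy hyW hpW
      refine ⟨y, ⟨⟨hvy, by tauto⟩, ?_⟩, hWe.symm⟩
      rw [hWe, hval_descComp hv hl hfe hvy (hXU hpX) hyV.2] at hodd
      have h1 := hbot y hvy hyX hpX
      have h2 := hfe y hvy
      obtain ⟨k, hk⟩ := hodd
      omega
    · rintro ⟨y, hy, rfl⟩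
      obtain ⟨h1, h2, h3⟩ := hYp y hy
      have hyA : y ∈ A := ⟨Or.inr h1, h3⟩
      have hpA : R.par y ∉ A := fun h => h.2 (hXU h2)
      have hC : R.IsComp v A (R.descComp A y) := descComp_isComp hv hyA hpA
      refine ⟨hC, ?_, y, ⟨below_refl y, fun x h4 h5 => h5.antisymm h4 ▸ hyA⟩,
        fun h => hpA (hC.2.1 h), h2⟩
      rw [hval_descComp hv hl hfe h1 (hXU h2) h3]
      have := hy.2
      exact ⟨0, by omega⟩
  have hinj : Set.InjOn (R.descComp A) Y := by
    have key : ∀ y ∈ Y, y ∈ R.descComp A y := fun y hy =>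
      ⟨below_refl y, fun x h4 h5 => h5.antisymm h4 ▸ ⟨Or.inr (hYp y hy).1, (hYp y hy).2.2⟩⟩
    intro y hy y' hy' h
    have h1 : y' ∈ R.descComp A y := by rw [h]; exact key y' hy'
    have h2 : y ∈ R.descComp A y' := by rw [← h]; exact key y hy
    exact h1.1.antisymm h2.1
  rw [himg, hinj.ncard_image, hval_eq_sum, hval_eq_sum]
  have hcard : Y.ncard = ∑ e : V, if e ∈ Y then 1 else 0 := by
    rw [Set.ncard_eq_toFinset_card', ← Finset.card_filter]
    congr 1
    ext e
    simp
  rw [hcard, ← Finset.sum_add_distrib]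
  refine Finset.sum_congr rfl fun e _ => ?_
  by_cases he : e ∈ R.cutE v X
  · obtain ⟨h1, h2⟩ := id he
    have h3 := hfe e h1
    have h4 : R.c e ≤ f e + 1 := by
      by_cases heX : e ∈ X
      · have := htop e h1 heX (by tauto)
        omega
      · exact hbot e h1 heX (by tauto)
    by_cases h5 : f e + 1 = R.c e
    · have : e ∈ Y := ⟨he, h5⟩
      simp [he, this, h5]
    · have : e ∉ Y := fun h => h5 h.2
      simp only [he, this, if_true, if_false]
      omega
  · have : e ∉ Y := fun h => he h.1
    simp [he, this]

lemma isBlocking_iff [Fintype V] (hv : v ≠ R.root) : R.IsBlocking v f ↔ R.Blk v f := by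
  constructor
  · rintro ⟨h1, h2, h3, h4, h5⟩
    have hd : ∀ t ∈ R.Te v, ∀ t' ∈ R.Te v, ∀ x ∈ R.Vf v f t, x ∈ R.Vf v f t' → t = t' := by
      intro t ht t' ht' x hx hx'
      by_contra hne
      have := h4 t ht t' ht' hne
      exact (this ▸ (⟨hx, hx'⟩ : x ∈ R.Vf v f t ∩ R.Vf v f t') : x ∈ (∅ : Set V))
    exact ⟨h1.loc hv, h2, h3, hd, fun t ht => (bal_iff hv (h1.loc hv) h3 hd ht).1 (h5 t ht).1⟩
  · rintro ⟨h1, h2, h3, h4, h5⟩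
    refine ⟨h1.isFlow hv, h2, h3, fun t ht t' ht' hne => ?_, fun t ht => ⟨?_, ?_⟩⟩
    · ext x
      simp only [Set.mem_inter_iff, Set.mem_empty_iff_false, iff_false]
      rintro ⟨hx, hx'⟩
      exact hne (h4 t ht t' ht' x hx hx')
    · exact (bal_iff hv h1 h3 h4 ht).2 (h5 t ht)
    · exact hval_add_odd hv h1 h2 h3 h4 ht

lemma Blk.restrict (h : R.Blk v f) (hx : R.below v x)
    (ha : ∀ t ∈ R.Te x, R.par x ∉ R.Vf v f t) : R.Blk x f := by
  have hT : ∀ t ∈ R.Te x, t ∈ R.Te v := fun t ht => ⟨hx.trans ht.1, ht.2⟩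
  refine ⟨h.loc.mono hx, fun w hw => h.feasible w (hx.trans hw),
    fun t ht hp => ha t ht (Vf_mono hx hp), ?_, ?_⟩
  · intro t ht t' ht' y hy hy'
    exact h.disjoint t (hT t ht) t' (hT t' ht') y (Vf_mono hx hy) (Vf_mono hx hy')
  · intro t ht y hy
    exact h.bal t (hT t ht) y (Vf_mono hx hy)

lemma Psi_le [Fintype V] {n : ℕ} (h : n ∈ R.Psi v) : n ≤ R.c v := by
  obtain ⟨f, hf, rfl⟩ := h
  exact hf.2.1 v (below_refl v)

lemma Psi_bddAbove [Fintype V] : BddAbove (R.Psi v) := ⟨R.c v, fun _ h => Psi_le h⟩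

lemma aE_le {n : ℕ} (h : n ∈ R.Psi v) : R.aE v ≤ n := Nat.sInf_le h

lemma le_bE [Fintype V] {n : ℕ} (h : n ∈ R.Psi v) : n ≤ R.bE v := le_csSup Psi_bddAbove h

lemma aE_mem (h : (R.Psi v).Nonempty) : R.aE v ∈ R.Psi v := Nat.sInf_mem h

lemma bE_mem [Fintype V] (h : (R.Psi v).Nonempty) : R.bE v ∈ R.Psi v :=
  Nat.sSup_mem h Psi_bddAbove

lemma Blk.mem_Psi [Fintype V] (hv : v ≠ R.root) (h : R.Blk v f) : f v ∈ R.Psi v :=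
  ⟨f, (isBlocking_iff hv).2 h, rfl⟩

lemma Down.not_mem_Vf (hq : v ≠ R.root) (hD : R.Down f (R.par v) w)
    (ha : R.par v ∉ R.Vf v f t) : w ∉ R.Vf v f t := by
  intro hw
  obtain ⟨_, z, h2, h3, h4⟩ := mem_Vf.1 hw
  rcases h2 with rfl | hvz
  · exact ha (mem_Vf_of_Up (Or.inl rfl) h3)
  · refine ha (mem_Vf_of_Up (Or.inl rfl) (h3.extend hq hvz fun x h5 h6 => ?_))
    have := hD.2 x ((par_below hq).trans h5) (h6.trans h4.1)
      (fun h => not_below_par hq (h ▸ h5))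
    omega

/-- In a blocking flow of maximum value on `e`, no path between two lower terminals meets the
set reachable downwards from the top terminal. -/
lemma Blk.balanced_of_eq_bE [Fintype V] (hv : v ≠ R.root) (h : R.Blk v f) (hb : f v = R.bE v)
    (hx : R.below v x) (hD : R.Down f (R.par v) x) (hF : R.Fork x y z) : f x = f y + f z := by
  by_contra hne
  have hlx := h.loc x y z hx hF
  have hlt : f x + 2 ≤ f y + f z := by
    obtain ⟨⟨k, hk⟩, h2, h3⟩ := hlx
    omega
  let f' : V → ℕ := fun e => if R.below v e ∧ R.below e x then f e + 2 else f e
  have hle : ∀ e, f e ≤ f' e := fun e => by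
    by_cases he : R.below v e ∧ R.below e x <;> simp [f', he]
  have hpos : ∀ e, R.below v e → R.below e x → f' e = f e + 2 := fun e h1 h2 => if_pos ⟨h1, h2⟩
  have hneg : ∀ e, ¬ R.below e x → f' e = f e := fun e h1 => if_neg fun h2 => h1 h2.2
  have hsub : ∀ t, R.Vf v f' t ⊆ R.Vf v f t := fun t => Vf_anti hle
  have hB : R.Blk v f' := by
    refine ⟨?_, ?_, fun t ht hp => h.avoid t ht (hsub t hp), ?_, ?_⟩
    · intro k l m hk hG
      have e1 := h.loc k l m hk hG
      by_cases hkx : R.below k x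
      · have e2 := hpos k hk hkx
        rcases hG.cases hkx with rfl | hlx | hmx
        · have hlm : f x + 2 ≤ f l + f m := by
            have hs := hF.sum_children f
            rw [hG.sum_children f] at hs
            omega
          rw [e2, hneg l hG.not_left_below, hneg m hG.not_right_below]
          obtain ⟨⟨k, hk⟩, h2, h3⟩ := e1
          exact ⟨⟨k + 1, by omega⟩, by omega, by omega⟩
        · rw [e2, hpos l (hk.trans hG.below_left) hlx, hneg m fun h => hG.not_both hlx h]
          obtain ⟨⟨k, hk⟩, h2, h3⟩ := e1
          exact ⟨⟨k + 2, by omega⟩, by omega, by omega⟩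
        · rw [e2, hpos m (hk.trans hG.below_right) hmx, hneg l fun h => hG.not_both h hmx]
          obtain ⟨⟨k, hk⟩, h2, h3⟩ := e1
          exact ⟨⟨k + 2, by omega⟩, by omega, by omega⟩
      · rw [hneg k hkx, hneg l fun h => hkx (hG.below_left.trans h),
          hneg m fun h => hkx (hG.below_right.trans h)]
        exact e1
    · intro e he
      by_cases hex : R.below e x
      · rw [hpos e he hex]
        exact hD.2 e ((par_below hv).trans he) hex fun h => not_below_par hv (h ▸ he)
      · rw [hneg e hex]
        exact h.feasible e he
    · intro t ht t' ht' e he he'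
      exact h.disjoint t ht t' ht' e (hsub t he) (hsub t' he')
    · intro t ht k hk hkt l m hG
      have hk' := hsub t hk
      have hvk := Vf_subset (h.avoid t ht) hk'
      have hkx : ¬ R.below k x := by
        intro hkx
        exact (hD.mono_bot ((par_below hv).trans hvk) hkx).not_mem_Vf hv (h.avoid t ht) hk'
      rw [hneg k hkx, hneg l fun h => hkx (hG.below_left.trans h),
        hneg m fun h => hkx (hG.below_right.trans h)]
      exact h.bal t ht k hk' hkt l m hG
  have := le_bE (hB.mem_Psi hv)
  rw [hpos v (below_refl v) hx] at this
  omega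

end Blocking

end RTI

namespace RTI

section Paths

variable {V : Type*} {R : RTI V} {f f₁ f₂ : V → ℕ} {p s t v w w₁ w₂ x y z y' z' : V} {δ : ℕ}

lemma Fork.eq_of_below (hF : R.Fork x y z) (hG : R.Fork x y' z') (hy : R.below y s)
    (hy' : R.below y' s) : y = y' ∧ z = z' := by
  have h1 : y' ∈ ({y, z} : Set V) := hF.children_eq ▸ hG.mem_left
  have h2 : z' ∈ ({y, z} : Set V) := hF.children_eq ▸ hG.symm.mem_left
  have h3 : y' = y := by
    rcases h1 with h1 | h1
    · exact h1
    · exact (hF.not_both hy (h1 ▸ hy')).elim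
  refine ⟨h3.symm, ?_⟩
  rcases h2 with h2 | h2
  · exact (hG.ne (h3.trans h2.symm)).elim
  · exact h2.symm

/-- Two distinct leaves are incomparable. -/
lemma leaf.not_below (ht : R.leaf t) (hne : t ≠ s) : ¬ R.below t s :=
  fun h => hne (ht.eq_of_below h).symm

/-- A vertex off the path from `w` to the leaf `s` hangs below a vertex of that path. -/
lemma exists_branch [Finite V] (hw : w ≠ R.root) (hs : s ∈ R.Te w) (hx : R.below w x)
    (hxs : ¬ R.below x s) : ∃ p y z, R.below w p ∧ R.Fork p y z ∧ R.below y s ∧ R.below z x := by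
  refine exists_fork_of_not_below hw hs.1 hx (fun h => hxs ?_) hxs
  rw [hs.2.eq_of_below h]
  exact below_refl s

lemma path_induction [Finite V] {Q : V → Prop} (hw : w ≠ R.root) (hs : s ∈ R.Te w) (base : Q w)
    (step : ∀ p y z, R.below w p → R.Fork p y z → R.below y s → Q p → Q y)
    (hp : R.below w p) (hps : R.below p s) : Q p := by
  induction hp with
  | refl => exact base
  | tail hbc hcd ih =>
    rename_i b d
    have hwb : R.below w b := hbc
    have hbd : R.below b d := Relation.ReflTransGen.single hcd
    have hbs := hbd.trans hps
    have hne : b ≠ s := by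
      rintro rfl
      exact hs.2.2 d hcd.2 hcd.1
    obtain ⟨y, z, hF, hy⟩ := exists_fork_of_below_ne (hwb.ne_root hw) hbs hne
    have hd : d ∈ ({y, z} : Set V) := hF.children_eq ▸ (⟨hcd.1, hcd.2⟩ : d ∈ R.children b)
    rcases hd with rfl | rfl
    · exact step b d z hwb hF hy (ih hbs)
    · exact (hF.not_both hy hps).elim

lemma Dominating.fork (hF : R.Fork x y z) (h : R.Dominating y) : R.bE z + 2 ≤ R.aE y := by
  obtain ⟨_, y', h1, h2, h3, h4⟩ := h
  have : y' ∈ ({y, z} : Set V) :=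
    hF.children_eq ▸ (⟨h3.trans hF.par_left, h1⟩ : y' ∈ R.children x)
  rcases this with rfl | rfl
  · exact (h2 rfl).elim
  · exact h4

lemma Dominating.aE_le_bE [Fintype V] (h : R.Dominating y) : R.aE y ≤ R.bE y := by
  obtain ⟨_, y', -, -, -, h4⟩ := h
  rcases Set.eq_empty_or_nonempty (R.Psi y) with h5 | h5
  · have : R.aE y = 0 := by rw [aE, h5, Nat.sInf_empty]
    omega
  · exact aE_le (bE_mem h5)

lemma Dominating.not_sibling [Fintype V] (hF : R.Fork x y z) (hy : R.Dominating y) :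
    ¬ R.Dominating z := by
  intro hz
  have h1 := hy.fork hF
  have h2 := hz.fork hF.symm
  have h3 := hy.aE_le_bE
  have h4 := hz.aE_le_bE
  omega

lemma DomPath.eq [Fintype V] (hw : w ≠ R.root) (hs : R.DomPath w s) (ht : R.DomPath w t)
    (hsl : R.leaf s) (htl : R.leaf t) : s = t := by
  by_contra hne
  obtain ⟨k, y, y', hk, hF, hy, hy'⟩ := exists_fork_of_not_below hw hs.1 ht.1
    (hsl.not_below hne) (htl.not_below (Ne.symm hne))
  refine Dominating.not_sibling hF (hs.2 y (hk.trans hF.below_left) hy ?_)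
    (ht.2 y' (hk.trans hF.below_right) hy' ?_)
  · rintro rfl
    exact hF.not_left_below hk
  · rintro rfl
    exact hF.not_right_below hk

lemma CondB.le_of_domPath [Fintype V] {g : Sym2 V → ℕ} (hB : R.CondB w) (hw : w ≠ R.root)
    (hs : R.DomPath w s) (hsl : R.leaf s) (hne : w ≠ s) (hf : R.IsBlocking w f)
    (hg : R.IsDecomp w f g) : R.aE w ≤ g s(R.par w, s) := by
  obtain ⟨y, z, hF, hy⟩ := exists_fork_of_below_ne hw hs.1 hne
  have hyw : y ≠ w := by
    rintro rfl
    exact hF.not_left_below (below_refl y)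
  obtain ⟨t, ht, htP, h⟩ := hB y hF.mem_left (hs.2 y hF.below_left hy hyw)
  rw [hs.eq hw htP hsl ht.2]
  exact h f g hf hg

/-- A blocking flow of `I(w)` of minimum value, for an edge whose lower endpoint is joined to the
terminal `s` by a dominating path used by the flow. -/
structure MinFlow (R : RTI V) (w s : V) (f : V → ℕ) : Prop where
  ne_root : w ≠ R.root
  blk : R.Blk w f
  mem : s ∈ R.Te w
  dom : ∀ p y z, R.below w p → R.Fork p y z → R.below y s → R.bE z + 2 ≤ R.aE y
  condA : ∀ p, R.below w p → R.CondA p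
  val : f w = R.aE w
  through : w = s ∨ ∃ g, R.IsDecomp w f g ∧ 1 ≤ g s(R.par w, s)

namespace MinFlow

/-- No vertex of the dominating path is reachable from another terminal. -/
lemma not_mem_Vf [Fintype V] (m : R.MinFlow w s f) (hps : R.below p s)
    (ht : t ∈ R.Te w) (hts : t ≠ s) : p ∉ R.Vf w f t := by
  intro hpt
  rcases m.through with rfl | ⟨g, hd, hg⟩
  · exact hts (m.mem.2.eq_of_below ht.1)
  obtain ⟨_, z, hzV, hU, hD⟩ := mem_Vf.1 hpt
  have hwz : R.below w z := by
    rcases hzV with rfl | h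
    · exact (m.blk.avoid t ht (mem_Vf_of_Up (Or.inl rfl) hU)).elim
    · exact h
  obtain ⟨k, y, y', hk, hF, hy, hy'⟩ := exists_fork_of_not_below (hwz.ne_root m.ne_root)
    (hD.1.trans hps) hU.1 (m.mem.2.not_below (Ne.symm hts)) (ht.2.not_below hts)
  have hwk := hwz.trans hk
  have hkX := mem_Vf_of_Up (Or.inr hwk) (hU.mono_top hk (hF.below_right.trans hy'))
  have hkt : k ≠ t := fun h => hF.not_leaf (h ▸ ht.2)
  have h1 := (m.blk.bal t ht k hkX hkt y' y hF.symm).1 hy'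
  obtain ⟨A, B, C, e1, e2, e3, h2⟩ := decomp_local m.ne_root hd hwk hF
  have hcross : ∀ x, R.below w x → R.below x s → R.Crosses x s(R.par w, s) := fun x h3 h4 =>
    crosses_mk.2 (Or.inr ⟨fun h5 => not_below_par m.ne_root (h3.trans h5), h4⟩)
  have := h2 _ (hcross k hwk (hF.below_left.trans hy))
    (hcross y (hwk.trans hF.below_left) hy)
  omega

lemma children_values [Fintype V] (m : R.MinFlow w s f) (hp : R.below w p)
    (hF : R.Fork p y z) (hy : R.below y s) (hpX : p ∉ R.Vf w f s) (hpa : f p = R.aE p) :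
    f y = R.aE y ∧ f z = R.bE z ∧ f y = f p + f z ∧ R.Blk z f := by
  have hav : ∀ t ∈ R.Te w, p ∉ R.Vf w f t := by
    intro t ht
    by_cases hts : t = s
    · exact hts ▸ hpX
    · exact m.not_mem_Vf (hF.below_left.trans hy) ht hts
  have hBy : R.Blk y f := m.blk.restrict (hp.trans hF.below_left) fun t ht => by
    rw [hF.par_left]
    exact hav t ⟨(hp.trans hF.below_left).trans ht.1, ht.2⟩
  have hBz : R.Blk z f := m.blk.restrict (hp.trans hF.below_right) fun t ht => by
    rw [hF.par_right]
    exact hav t ⟨(hp.trans hF.below_right).trans ht.1, ht.2⟩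
  have hyP := hBy.mem_Psi hF.left_ne_root
  have hzP := hBz.mem_Psi hF.right_ne_root
  have h1 := aE_le hyP
  have h2 := le_bE hzP
  have h3 := m.dom p y z hp hF hy
  have h4 := m.blk.feasible p hp
  have h5 := m.blk.loc p y z hp hF
  have h6 : R.aE y - R.bE z ∈ R.Psi p := by
    rw [(m.condA p hp).2.2 y z hF.ne hF.children_eq]
    refine Or.inl ⟨⟨R.aE y, aE_mem ⟨_, hyP⟩, R.bE z, bE_mem ⟨_, hzP⟩, R.bE z, ?_, ?_⟩, ?_⟩
    · exact le_min (by omega) le_rfl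
    · omega
    · rw [Set.mem_Iic]
      omega
  have h7 := aE_le h6
  exact ⟨by omega, by omega, by omega, hBz⟩

lemma eq_aE [Fintype V] (m : R.MinFlow w s f) (hp : R.below w p) (hps : R.below p s) :
    p ∉ R.Vf w f s → f p = R.aE p := by
  refine path_induction (Q := fun p => p ∉ R.Vf w f s → f p = R.aE p) m.ne_root m.mem
    (fun _ => m.val) ?_ hp hps
  intro p y z hp hF hy ih hyX
  have hpX : p ∉ R.Vf w f s := fun h =>
    hyX (mem_Vf_towards h hF.below_left hy (Or.inr (hp.trans hF.below_left)))
  exact (m.children_values hp hF hy hpX (ih hpX)).1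

/-- A minimum flow is balanced along the dominating path. -/
lemma path_bal [Fintype V] (m : R.MinFlow w s f) (hp : R.below w p) (hF : R.Fork p y z)
    (hy : R.below y s) : f y = f p + f z := by
  by_cases hpX : p ∈ R.Vf w f s
  · exact (m.blk.bal s m.mem p hpX (fun h => hF.not_leaf (h ▸ m.mem.2)) y z hF).1 hy
  · exact (m.children_values hp hF hy hpX
      (m.eq_aE hp (hF.below_left.trans hy) hpX)).2.2.1

lemma le_path [Fintype V] (m : R.MinFlow w s f) (hp : R.below w p) (hps : R.below p s) :
    f w ≤ f p := by
  refine path_induction (Q := fun p => f w ≤ f p) m.ne_root m.mem le_rfl ?_ hp hps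
  intro p y z hp hF hy ih
  have := m.path_bal hp hF hy
  omega

/-- Off the dominating path, a minimum flow is balanced at the vertices reachable downwards
from the path. -/
lemma branch_bal [Fintype V] (m : R.MinFlow w s f) {k l n : V} (hp : R.below w p)
    (hF : R.Fork p y z) (hy : R.below y s) (hk : R.below z k) (hD : R.Down f p k)
    (hG : R.Fork k l n) : f k = f l + f n := by
  by_cases hpX : p ∈ R.Vf w f s
  · have hkX := mem_Vf_of_Down hpX (Or.inr ((hp.trans hF.below_right).trans hk)) hD
    exact (m.blk.bal s m.mem k hkX (fun h => hG.not_leaf (h ▸ m.mem.2)) l n hG).2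
      fun h => hF.not_both hy (hk.trans h)
  · obtain ⟨-, h1, -, h2⟩ := m.children_values hp hF hy hpX
      (m.eq_aE hp (hF.below_left.trans hy) hpX)
    exact h2.balanced_of_eq_bE hF.right_ne_root h1 hk (hF.par_right.symm ▸ hD) hG

/-- The set reachable from another terminal does not meet the vertices reachable downwards from
the path. -/
lemma branch_not_mem [Fintype V] (m : R.MinFlow w s f) {k : V} (hp : R.below w p)
    (hF : R.Fork p y z) (hy : R.below y s) (hk : R.below z k) (hD : R.Down f p k)
    (ht : t ∈ R.Te w) (hts : t ≠ s) : k ∉ R.Vf w f t := by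
  intro hkX
  have hps := hF.below_left.trans hy
  refine m.not_mem_Vf hps ht hts (hF.par_right ▸ par_mem_Vf_of_Down hF.right_ne_root
    (hp.trans hF.below_right) hkX ?_ (hF.par_right.symm ▸ hD))
  intro z₀ h1 hU hD₀
  rcases hk.total hD₀.1 with h2 | h2
  · exact h2
  by_cases hne : z₀ = z
  · exact hne ▸ below_refl z₀
  have h3 : R.below z₀ p := hF.par_right ▸ h2.par_of_ne hne
  exfalso
  rcases h1.total ht.1 with h4 | h4
  · exact m.not_mem_Vf m.mem.1 ht hts
      (mem_Vf_of_Up (Or.inr (below_refl w)) (hU.mono_top h4 ht.1))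
  · exact m.not_mem_Vf (h3.trans hps) ht hts (mem_Vf_of_Up (Or.inr h4) hU)

end MinFlow

/-- A vertex of `V_f(s)` hanging below an ancestor `p` of `s` is reachable downwards from `p`. -/
lemma down_of_mem_Vf (hF : R.Fork p y z) (hy : R.below y s) (hx : R.below z x)
    (hxX : x ∈ R.Vf v f s) : R.Down f p x := by
  obtain ⟨_, z₀, _, hU, hD⟩ := mem_Vf.1 hxX
  have hpx := hF.below_right.trans hx
  rcases hD.1.total hpx with h | h
  · exact hD.mono_top h hpx
  · rcases hF.cases h with rfl | h | h
    · exact hD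
    · exact (hF.not_both (h.trans hD.1) hx).elim
    · exact (hF.not_both hy (h.trans hU.1)).elim

/-- `f` combines a minimum flow `f₁` of `I(w₁)`, decreased by `δ` along the dominating path,
with a maximum flow `f₂` of `I(w₂)`, and saturates the edge above `v`. -/
structure Combined (R : RTI V) (v w₁ w₂ s : V) (f₁ f₂ f : V → ℕ) (δ : ℕ) : Prop where
  ne_root : v ≠ R.root
  fork : R.Fork v w₁ w₂
  min : R.MinFlow w₁ s f₁
  blk₂ : R.Blk w₂ f₂
  val₂ : f₂ w₂ = R.bE w₂
  top : f v = R.c v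
  sum : f w₁ = f v + f w₂
  le : δ ≤ f₁ w₁
  path : ∀ x, R.below w₁ x → R.below x s → f x = f₁ x - δ
  left : ∀ x, R.below w₁ x → ¬ R.below x s → f x = f₁ x
  right : ∀ x, R.below w₂ x → f x = f₂ x

namespace Combined

lemma path_bal [Fintype V] (C : R.Combined v w₁ w₂ s f₁ f₂ f δ) (hx : R.below v x)
    (hF : R.Fork x y z) (hy : R.below y s) : f y = f x + f z := by
  rcases C.fork.cases hx with rfl | h | h
  · obtain ⟨rfl, rfl⟩ := C.fork.eq_of_below hF C.min.mem.1 hy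
    exact C.sum
  · have hxs := hF.below_left.trans hy
    have h1 := C.min.path_bal h hF hy
    have h2 := C.min.le_path h hxs
    have h3 := C.le
    rw [C.path x h hxs, C.path y (h.trans hF.below_left) hy,
      C.left z (h.trans hF.below_right) fun h' => hF.not_both hy h']
    omega
  · exact (C.fork.not_both C.min.mem.1 ((h.trans hF.below_left).trans hy)).elim

lemma loc [Fintype V] (C : R.Combined v w₁ w₂ s f₁ f₂ f δ) : R.Loc v f := by
  intro x y z hx hF
  by_cases hxs : R.below x s
  · have hsl : s ≠ x := fun h => hF.not_leaf (h ▸ C.min.mem.2)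
    rcases hF.cases hxs with h | h | h
    · exact (hsl h).elim
    · have := C.path_bal hx hF h
      exact ⟨⟨f y, by omega⟩, by omega, by omega⟩
    · have := C.path_bal hx hF.symm h
      exact ⟨⟨f z, by omega⟩, by omega, by omega⟩
  · have hys : ¬ R.below y s := fun h => hxs (hF.below_left.trans h)
    have hzs : ¬ R.below z s := fun h => hxs (hF.below_right.trans h)
    rcases C.fork.cases hx with rfl | h | h
    · exact (hxs (C.fork.below_left.trans C.min.mem.1)).elim
    · rw [C.left x h hxs, C.left y (h.trans hF.below_left) hys,
        C.left z (h.trans hF.below_right) hzs]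
      exact C.min.blk.loc x y z h hF
    · rw [C.right x h, C.right y (h.trans hF.below_left), C.right z (h.trans hF.below_right)]
      exact C.blk₂.loc x y z h hF

lemma feasible (C : R.Combined v w₁ w₂ s f₁ f₂ f δ) : R.Feasible v f := by
  intro x hx
  rcases C.fork.cases hx with rfl | h | h
  · exact C.top.le
  · have := C.min.blk.feasible x h
    by_cases hxs : R.below x s
    · rw [C.path x h hxs]
      omega
    · rw [C.left x h hxs]
      exact this
  · rw [C.right x h]
    exact C.blk₂.feasible x h

lemma below_of_up (C : R.Combined v w₁ w₂ s f₁ f₂ f δ) (ht : R.below v t) (hz : z ∈ R.Ve v)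
    (hU : R.Up f t z) : R.below v z := by
  rcases hz with rfl | h
  · have h1 := hU.2 v (par_below C.ne_root) ht (par_ne C.ne_root).symm
    have h2 := C.top
    omega
  · exact h

lemma avoid (C : R.Combined v w₁ w₂ s f₁ f₂ f δ) (ht : t ∈ R.Te v) :
    R.par v ∉ R.Vf v f t := by
  intro h
  obtain ⟨_, z, hz, hU, hD⟩ := mem_Vf.1 h
  exact not_below_par C.ne_root ((C.below_of_up ht.1 hz hU).trans hD.1)

/-- No ancestor of `s` is reachable upwards from another terminal of `I(w₁)`. -/
lemma not_up [Fintype V] (C : R.Combined v w₁ w₂ s f₁ f₂ f δ) (ht : t ∈ R.Te w₁)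
    (hts : t ≠ s) (hzs : R.below z s) : ¬ R.Up f t z := by
  suffices key : ∀ z, R.below w₁ z → R.below z s → ¬ R.Up f t z by
    intro hU
    rcases hzs.total C.min.mem.1 with h | h
    · exact key w₁ (below_refl w₁) C.min.mem.1 (hU.mono_top h ht.1)
    · exact key z h hzs hU
  intro z hz hzs hU
  obtain ⟨k, y, y', hk, hF, hy, hy'⟩ := exists_fork_of_not_below (hz.ne_root C.min.ne_root)
    hzs hU.1 (C.min.mem.2.not_below (Ne.symm hts)) (ht.2.not_below hts)
  have hwk := hz.trans hk
  refine C.min.not_mem_Vf (hF.below_left.trans hy) ht hts (mem_Vf_of_Up (Or.inr hwk)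
    ((hU.mono_top hk (hF.below_right.trans hy')).congr fun x h1 h2 h3 => ?_))
  refine (C.left x (hwk.trans h1) fun h4 => ?_).ge
  rcases hF.cases h1 with h5 | h5 | h5
  · exact h3 h5
  · exact hF.not_both (h5.trans h2) hy'
  · exact hF.not_both hy (h5.trans h4)

lemma Vf_left [Fintype V] (C : R.Combined v w₁ w₂ s f₁ f₂ f δ) (ht : t ∈ R.Te w₁)
    (hts : t ≠ s) (hx : x ∈ R.Vf v f t) : x ∈ R.Vf w₁ f₁ t := by
  obtain ⟨_, z, hz, hU, hD⟩ := mem_Vf.1 hx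
  have hzs : ¬ R.below z s := fun h => C.not_up ht hts h hU
  have hwz : R.below w₁ z := by
    rcases hU.1.total ht.1 with h | h
    · exact (hzs (h.trans C.min.mem.1)).elim
    · exact h
  have key : ∀ x, R.below z x → f₁ x ≤ f x := fun x h =>
    (C.left x (hwz.trans h) fun h' => hzs (h.trans h')).ge
  exact mem_Vf.2 ⟨Or.inr (hwz.trans hD.1), z, Or.inr hwz, hU.congr fun x h _ _ => key x h,
    hD.congr fun x h _ _ => key x h⟩

lemma Vf_right (C : R.Combined v w₁ w₂ s f₁ f₂ f δ) (ht : t ∈ R.Te w₂)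
    (hx : x ∈ R.Vf v f t) : x ∈ R.Vf w₂ f₂ t := by
  obtain ⟨_, z, hz, hU, hD⟩ := mem_Vf.1 hx
  have hwz : R.below w₂ z := by
    rcases hU.1.total ht.1 with h | h
    · by_cases hne : z = w₂
      · exact hne ▸ below_refl z
      exfalso
      have h1 : R.below z v := C.fork.par_right ▸ h.par_of_ne hne
      refine C.blk₂.avoid t ht (mem_Vf_of_Up (Or.inl rfl) ?_)
      rw [C.fork.par_right]
      refine (hU.mono_top h1 (C.fork.below_right.trans ht.1)).congr fun x h2 h3 h4 => ?_
      rcases C.fork.cases h2 with h5 | h5 | h5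
      · exact (h4 h5).elim
      · exact (C.fork.not_both (h5.trans h3) ht.1).elim
      · exact (C.right x h5).ge
    · exact h
  have key : ∀ x, R.below z x → f₂ x ≤ f x := fun x h => (C.right x (hwz.trans h)).ge
  exact mem_Vf.2 ⟨Or.inr (hwz.trans hD.1), z, Or.inr hwz, hU.congr fun x h _ _ => key x h,
    hD.congr fun x h _ _ => key x h⟩

lemma down_left (C : R.Combined v w₁ w₂ s f₁ f₂ f δ) (hp : R.below w₁ p) (hF : R.Fork p y z)
    (hy : R.below y s) (hx : R.below z x) (hxX : x ∈ R.Vf v f s) : R.Down f₁ p x := by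
  refine (down_of_mem_Vf hF hy hx hxX).congr fun k h1 h2 h3 => ?_
  refine (C.left k (hp.trans h1) fun h4 => ?_).ge
  rcases hF.cases h1 with h5 | h5 | h5
  · exact h3 h5
  · exact hF.not_both (h5.trans h2) hx
  · exact hF.not_both hy (h5.trans h4)

lemma down_right (C : R.Combined v w₁ w₂ s f₁ f₂ f δ) (hx : R.below w₂ x)
    (hxX : x ∈ R.Vf v f s) : R.Down f₂ (R.par w₂) x := by
  rw [C.fork.par_right]
  refine (down_of_mem_Vf C.fork C.min.mem.1 hx hxX).congr fun k h1 h2 h3 => ?_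
  rcases C.fork.cases h1 with h5 | h5 | h5
  · exact (h3 h5).elim
  · exact (C.fork.not_both (h5.trans h2) hx).elim
  · exact (C.right k h5).ge

lemma disjoint_path [Fintype V] (C : R.Combined v w₁ w₂ s f₁ f₂ f δ) (ht : t ∈ R.Te v)
    (hts : t ≠ s) (hx : x ∈ R.Vf v f s) : x ∉ R.Vf v f t := by
  intro hxt
  rcases C.fork.cases ht.1 with h | h | h
  · exact C.fork.not_leaf (h ▸ ht.2)
  · have h1 := C.Vf_left ⟨h, ht.2⟩ hts hxt
    have h2 := Vf_subset (C.min.blk.avoid t ⟨h, ht.2⟩) h1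
    by_cases hxs : R.below x s
    · exact C.min.not_mem_Vf hxs ⟨h, ht.2⟩ hts h1
    · obtain ⟨p, y, z, hp, hF, hy, hz⟩ := exists_branch C.min.ne_root C.min.mem h2 hxs
      exact C.min.branch_not_mem hp hF hy hz (C.down_left hp hF hy hz hx) ⟨h, ht.2⟩ hts h1
  · have h1 := C.Vf_right ⟨h, ht.2⟩ hxt
    have h2 := C.blk₂.avoid t ⟨h, ht.2⟩
    exact (C.down_right (Vf_subset h2 h1) hx).not_mem_Vf C.fork.right_ne_root h2 h1

lemma disjoint [Fintype V] (C : R.Combined v w₁ w₂ s f₁ f₂ f δ) :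
    ∀ t ∈ R.Te v, ∀ t' ∈ R.Te v, ∀ x ∈ R.Vf v f t, x ∈ R.Vf v f t' → t = t' := by
  intro t ht t' ht' x hx hx'
  by_contra hne
  by_cases hts : t = s
  · subst hts
    exact C.disjoint_path ht' (Ne.symm hne) hx hx'
  by_cases hts' : t' = s
  · subst hts'
    exact C.disjoint_path ht hne hx' hx
  have hl : ∀ t, t ∈ R.Te w₁ → t ≠ s → x ∈ R.Vf v f t → R.below w₁ x := fun t h1 h2 h3 =>
    Vf_subset (C.min.blk.avoid t h1) (C.Vf_left h1 h2 h3)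
  have hr : ∀ t, t ∈ R.Te w₂ → x ∈ R.Vf v f t → R.below w₂ x := fun t h1 h3 =>
    Vf_subset (C.blk₂.avoid t h1) (C.Vf_right h1 h3)
  rcases C.fork.cases ht.1 with h | h | h
  · exact C.fork.not_leaf (h ▸ ht.2)
  · rcases C.fork.cases ht'.1 with h' | h' | h'
    · exact C.fork.not_leaf (h' ▸ ht'.2)
    · exact hne (C.min.blk.disjoint t ⟨h, ht.2⟩ t' ⟨h', ht'.2⟩ x
        (C.Vf_left ⟨h, ht.2⟩ hts hx) (C.Vf_left ⟨h', ht'.2⟩ hts' hx'))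
    · exact C.fork.not_both (hl t ⟨h, ht.2⟩ hts hx) (hr t' ⟨h', ht'.2⟩ hx')
  · rcases C.fork.cases ht'.1 with h' | h' | h'
    · exact C.fork.not_leaf (h' ▸ ht'.2)
    · exact C.fork.not_both (hl t' ⟨h', ht'.2⟩ hts' hx') (hr t ⟨h, ht.2⟩ hx)
    · exact hne (C.blk₂.disjoint t ⟨h, ht.2⟩ t' ⟨h', ht'.2⟩ x
        (C.Vf_right ⟨h, ht.2⟩ hx) (C.Vf_right ⟨h', ht'.2⟩ hx'))

lemma bal_path [Fintype V] (C : R.Combined v w₁ w₂ s f₁ f₂ f δ) :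
    R.Bal f (R.Vf v f s) s := by
  have hsv : s ∈ R.Te v := ⟨C.fork.below_left.trans C.min.mem.1, C.min.mem.2⟩
  intro k hk _ l n hG
  have hvk := Vf_subset (C.avoid hsv) hk
  refine ⟨fun h => C.path_bal hvk hG h, fun hks => ?_⟩
  rcases C.fork.cases hvk with rfl | h | h
  · exact (hks hsv.1).elim
  · obtain ⟨p, y, z, hp, hF, hy, hz⟩ := exists_branch C.min.ne_root C.min.mem h hks
    rw [C.left k h hks,
      C.left l (h.trans hG.below_left) fun h' => hks (hG.below_left.trans h'),
      C.left n (h.trans hG.below_right) fun h' => hks (hG.below_right.trans h')]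
    exact C.min.branch_bal hp hF hy hz (C.down_left hp hF hy hz hk) hG
  · rw [C.right k h, C.right l (h.trans hG.below_left), C.right n (h.trans hG.below_right)]
    exact C.blk₂.balanced_of_eq_bE C.fork.right_ne_root C.val₂ h (C.down_right h hk) hG

lemma bal [Fintype V] (C : R.Combined v w₁ w₂ s f₁ f₂ f δ) (ht : t ∈ R.Te v) :
    R.Bal f (R.Vf v f t) t := by
  by_cases hts : t = s
  · exact hts ▸ C.bal_path
  intro k hk hkt l n hG
  rcases C.fork.cases ht.1 with h | h | h
  · exact (C.fork.not_leaf (h ▸ ht.2)).elim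
  · have h1 := C.Vf_left ⟨h, ht.2⟩ hts hk
    have h2 := Vf_subset (C.min.blk.avoid t ⟨h, ht.2⟩) h1
    have hks : ¬ R.below k s := fun h' => C.min.not_mem_Vf h' ⟨h, ht.2⟩ hts h1
    rw [C.left k h2 hks,
      C.left l (h2.trans hG.below_left) fun h' => hks (hG.below_left.trans h'),
      C.left n (h2.trans hG.below_right) fun h' => hks (hG.below_right.trans h')]
    exact C.min.blk.bal t ⟨h, ht.2⟩ k h1 hkt l n hG
  · have h1 := C.Vf_right ⟨h, ht.2⟩ hk
    have h2 := Vf_subset (C.blk₂.avoid t ⟨h, ht.2⟩) h1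
    rw [C.right k h2, C.right l (h2.trans hG.below_left), C.right n (h2.trans hG.below_right)]
    exact C.blk₂.bal t ⟨h, ht.2⟩ k h1 hkt l n hG

lemma blk [Fintype V] (C : R.Combined v w₁ w₂ s f₁ f₂ f δ) : R.Blk v f :=
  ⟨C.loc, C.feasible, fun _ ht => C.avoid ht, C.disjoint, fun _ ht => C.bal ht⟩

end Combined

end Paths

/-- The least element of a product of sets whose first factor lies above the second. -/
lemma left_eq_sub_of_otimes_eq_Iv {A B : Set ℕ} {a b ta tb : ℕ} (ha : a ∈ A) (hb : b ∈ B)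
    (hA : ∀ n ∈ A, a ≤ n) (hB : ∀ n ∈ B, n ≤ b) (hab : b ≤ a)
    (h : otimes A B = Iv ta tb) : ta = a - b := by
  have h1 : a - b ∈ Iv ta tb := by
    rw [← h]
    exact ⟨a, ha, b, hb, b, le_min hab le_rfl, by omega⟩
  obtain ⟨h2, h3, -⟩ := h1
  have h4 : ta ∈ otimes A B := by
    rw [h]
    exact ⟨le_rfl, by omega, rfl⟩
  obtain ⟨a', ha', b', hb', i, hi, h5⟩ := h4
  have h6 := hA a' ha'
  have h7 := hB b' hb'
  have h8 := le_min_iff.1 hi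
  omega

end RTI

/-- Main Lemma (v): with the induction hypotheses of the Main Lemma,
assume `c(e) < ã` and that `e₁` is dominating, with the dominating path `P_{v,t*}`
to the terminal `t* ∈ T_{e₁}` guaranteed by condition (b).  Then `I(e)` admits a
blocking flow with value `c(e)` on `e`; namely, for any blocking flow `f₁` of `I(e₁)`
with `f₁(e₁) = a(e₁)` and any blocking flow `f₂` of `I(e₂)` with `f₂(e₂) = b(e₂)`,
the function `f` that equals `f₁` decreased by `δ_e = ã − c(e)` on the edges of
`P_{v,t*}` in `G_{e₁}`, equals `f₁` on the other edges of `G_{e₁}`, equals `f₂` on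
`G_{e₂}`, and has `f(e) = c(e)`, is a blocking flow of `I(e)`. -/
theorem RTI.mainLemma_v {V : Type*} [Fintype V] [DecidableEq V]
    (R : RTI V) (v : V) (hv : v ≠ R.root)
    (w₁ w₂ : V) (hw : w₁ ≠ w₂) (hch : R.children v = {w₁, w₂})
    (hind : ∀ x, x ≠ R.root → R.dep v < R.dep x → R.CondA x ∧ R.CondB x)
    (ta tb : ℕ) (hab : otimes (R.Psi w₁) (R.Psi w₂) = Iv ta tb)
    (hlt : R.c v < ta) (hdom : R.Dominating w₁)
    (tstar : V) (hts : tstar ∈ R.Te w₁) (htsP : R.DomPath v tstar)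
    (htsB : ∀ f g, R.IsBlocking v f → R.IsDecomp v f g → R.aE v ≤ g s(R.par v, tstar))
    (f₁ : V → ℕ) (hf₁ : R.IsBlocking w₁ f₁) (hf₁v : f₁ w₁ = R.aE w₁)
    (f₂ : V → ℕ) (hf₂ : R.IsBlocking w₂ f₂) (hf₂v : f₂ w₂ = R.bE w₂)
    (f : V → ℕ) (hfv : f v = R.c v)
    (hfP : ∀ z, R.below w₁ z → R.below z tstar → f z = f₁ z - (ta - R.c v))
    (hfnP : ∀ z, R.below w₁ z → ¬ R.below z tstar → f z = f₁ z)
    (hf2 : ∀ z, R.below w₂ z → f z = f₂ z) :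
    R.IsBlocking v f ∧ ∃ f' : V → ℕ, R.IsBlocking v f' ∧ f' v = R.c v := by
  classical
  have hF : R.Fork v w₁ w₂ := ⟨hw, hch⟩
  have hw₁ := hF.left_ne_root
  have hw₂ := hF.right_ne_root
  have hdep : ∀ x, R.below w₁ x → R.dep v < R.dep x := fun x hx =>
    (hF.below_left.trans hx).dep_lt fun h => hF.not_left_below (h.symm ▸ hx)
  have hB₁ := (isBlocking_iff hw₁).1 hf₁
  have hB₂ := (isBlocking_iff hw₂).1 hf₂
  have ha : R.aE w₁ ∈ R.Psi w₁ := ⟨f₁, hf₁, hf₁v⟩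
  have hb : R.bE w₂ ∈ R.Psi w₂ := ⟨f₂, hf₂, hf₂v⟩
  have hdw := hdom.fork hF
  have hta : ta = R.aE w₁ - R.bE w₂ := left_eq_sub_of_otimes_eq_Iv ha hb
    (fun _ h => aE_le h) (fun _ h => le_bE h) (by omega) hab
  have hP₁ : R.DomPath w₁ tstar := ⟨hts.1, fun x h1 h2 _ =>
    htsP.2 x (hF.below_left.trans h1) h2 fun h => hF.not_left_below (h ▸ h1)⟩
  have hm : R.MinFlow w₁ tstar f₁ := by
    refine ⟨hw₁, hB₁, hts, fun p y z hp hG hy => ?_, fun p hp =>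
      (hind p (hp.ne_root hw₁) (hdep p hp)).1, hf₁v, ?_⟩
    · refine Dominating.fork hG (hP₁.2 y (hp.trans hG.below_left) hy ?_)
      rintro rfl
      exact hG.not_left_below hp
    · by_cases hne : w₁ = tstar
      · exact Or.inl hne
      · obtain ⟨g, hg⟩ := hf₁.1
        have := (hind w₁ hw₁ (hdep w₁ (below_refl w₁))).2.le_of_domPath hw₁ hP₁ hts.2 hne hf₁ hg
        exact Or.inr ⟨g, hg, by omega⟩
  have hC : R.Combined v w₁ w₂ tstar f₁ f₂ f (ta - R.c v) := by
    refine ⟨hv, hF, hm, hB₂, hf₂v, hfv, ?_, by omega, hfP, hfnP, hf2⟩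
    rw [hfP w₁ (below_refl w₁) hts.1, hf2 w₂ (below_refl w₂)]
    omega
  have hf := (isBlocking_iff hv).2 hC.blk
  exact ⟨hf, f, hf, hfv⟩
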